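/- arXiv:1301.6047 — 2 statements merged into one kernel-verified Lean document; each statement's English description precedes it below -/
import Mathlib

section
/- Let l ≥ 2π and define u on the unit cone ball C_1 of length l by u(r, θ) = r sin θ for θ ∈ [0, π] and u(r, θ) = 0 for θ ∈ [π, l], extended l-periodically in θ. Then u is a minimizer of J(C_1, 1, 0): for every Lipschitz function w on the cone with w(1, θ) = u(1, θ) for all θ, J(u, C_1) ≤ J(w, C_1). In particular, on every cone of length l ≥ 2π there is a minimizer whose free boundary passes through the vertex. -/
open MeasureTheory Set

noncomputable section

/-- The cone distance on the cone of length `l`, in polar coordinates: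
`d((r,θ),(s,φ)) = sqrt(r² + s² − 2 r s cos(min(δ, π)))` with
`δ = min_{k ∈ ℤ} |θ − φ + k l|`. -/
def coneDist (l : ℝ) (p q : ℝ × ℝ) : ℝ :=
  Real.sqrt (p.1 ^ 2 + q.1 ^ 2 -
    2 * p.1 * q.1 * Real.cos (min (⨅ k : ℤ, |p.2 - q.2 + (k : ℝ) * l|) Real.pi))

/-- A Lipschitz function on the cone ball `C_R` of the cone of length `l`, given in
polar coordinates: `l`-periodic in `θ` and Lipschitz for the cone distance (this forces
a well-defined vertex value `u 0 _` and continuity at the vertex). -/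
structure ConeLip (l R : ℝ) (u : ℝ → ℝ → ℝ) : Prop where
  periodic : ∀ r θ : ℝ, u r (θ + l) = u r θ
  lipschitz : ∃ K : ℝ, ∀ p q : ℝ × ℝ, p.1 ∈ Set.Icc 0 R → q.1 ∈ Set.Icc 0 R →
    |u p.1 p.2 - u q.1 q.2| ≤ K * coneDist l p q

/-- The squared cone gradient `|Du|² = (∂_r u)² + (∂_θ u)²/r²` at a polar point,
computed from Lean's a.e.-defined derivatives. -/
def gradSq (u : ℝ → ℝ → ℝ) (p : ℝ × ℝ) : ℝ :=
  (deriv (fun s => u s p.2) p.1) ^ 2 + (deriv (fun φ => u p.1 φ) p.2) ^ 2 / p.1 ^ 2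

/-- The two-phase functional
`J(u, C_R) = ∫_{C_R} |Du|² + λ₊ area({u > 0} ∩ C_R) + λ₋ area({u < 0} ∩ C_R)`,
computed in polar coordinates with area measure `r dr dθ`, `θ` ranging over `(0, l)`. -/
def Jfun (l lp lm : ℝ) (u : ℝ → ℝ → ℝ) (R : ℝ) : ℝ :=
  ∫ p in Set.Ioo (0:ℝ) R ×ˢ Set.Ioo (0:ℝ) l,
    (gradSq u p + (if 0 < u p.1 p.2 then lp else 0)
      + (if u p.1 p.2 < 0 then lm else 0)) * p.1

/-- The Dirichlet energy `∫_{C_R} |Du|²` with respect to the area measure `r dr dθ`. -/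
def Dir (l : ℝ) (u : ℝ → ℝ → ℝ) (R : ℝ) : ℝ :=
  ∫ p in Set.Ioo (0:ℝ) R ×ˢ Set.Ioo (0:ℝ) l, gradSq u p * p.1

/-- `u` is a minimizer of `J(C_R, λ₊, λ₋)` on the cone of length `l`: a cone Lipschitz
function beating every cone Lipschitz competitor with the same boundary values on
`{r = R}`. -/
def IsMinimizerJ (l lp lm R : ℝ) (u : ℝ → ℝ → ℝ) : Prop :=
  ConeLip l R u ∧ ∀ w : ℝ → ℝ → ℝ, ConeLip l R w → (∀ θ : ℝ, w R θ = u R θ) →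
    Jfun l lp lm u R ≤ Jfun l lp lm w R

/-- The representative of `θ` modulo `l` in `[0, l)`. -/
def thetaMod (l θ : ℝ) : ℝ := θ - l * (⌊θ / l⌋ : ℝ)

/-- The one-phase profile on the cone of length `l`: `u(r,θ) = r sin θ` for
`θ ∈ [0, π]` and `u = 0` for `θ ∈ [π, l]`, extended `l`-periodically. -/
def uOnePhase (l : ℝ) (r θ : ℝ) : ℝ :=
  if thetaMod l θ ≤ Real.pi then r * Real.sin (thetaMod l θ) else 0

open Filter Topology

/-! ### Cone distance -/

lemma delta_bdd (l x : ℝ) : BddBelow (Set.range fun k : ℤ => |x + (k : ℝ) * l|) :=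
  ⟨0, by rintro _ ⟨k, rfl⟩; exact abs_nonneg _⟩

lemma delta_nonneg (l x : ℝ) : 0 ≤ ⨅ k : ℤ, |x + (k : ℝ) * l| :=
  Real.iInf_nonneg fun _ => abs_nonneg _

lemma delta_le (l x : ℝ) : (⨅ k : ℤ, |x + (k : ℝ) * l|) ≤ |x| := by
  have := ciInf_le (delta_bdd l x) 0
  simpa using this

/-- Upper bound for the cone distance. -/
lemma coneDist_le (l : ℝ) (r s θ φ : ℝ) (hr : 0 ≤ r) (hs : 0 ≤ s) :
    coneDist l (r, θ) (s, φ) ≤ Real.sqrt ((r - s) ^ 2 + r * s * (θ - φ) ^ 2) := by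
  unfold coneDist
  apply Real.sqrt_le_sqrt
  simp only
  set m := min (⨅ k : ℤ, |θ - φ + (k : ℝ) * l|) Real.pi with hm
  have h0 : 0 ≤ m := le_min (delta_nonneg _ _) Real.pi_pos.le
  have h1 : m ≤ |θ - φ| := (min_le_left _ _).trans (delta_le _ _)
  have h2 : m ^ 2 ≤ (θ - φ) ^ 2 := by
    rw [← sq_abs (θ - φ)]; gcongr
  have h3 := Real.one_sub_sq_div_two_le_cos (x := m)
  have h4 : 0 ≤ r * s := mul_nonneg hr hs
  nlinarith [mul_le_mul_of_nonneg_left h2 h4, mul_le_mul_of_nonneg_left h3 h4]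

/-- Lower bound for the cone distance. -/
lemma le_coneDist (l : ℝ) (r s θ φ g : ℝ) (hr : 0 ≤ r) (hs : 0 ≤ s) (hg : 0 ≤ g)
    (hgk : ∀ k : ℤ, g ≤ |θ - φ + (k : ℝ) * l|) (hg1 : g ≤ 1) :
    |r - s| + min r s * g ≤ (1 + Real.pi / 2) * coneDist l (r, θ) (s, φ) := by
  unfold coneDist
  simp only
  set m := min (⨅ k : ℤ, |θ - φ + (k : ℝ) * l|) Real.pi with hm
  have hpi := Real.pi_gt_three
  have h0 : g ≤ m := le_min (le_ciInf hgk) (by linarith)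
  have h1 : m ≤ Real.pi := min_le_right _ _
  have h3 := Real.cos_le_one_sub_mul_cos_sq (x := m) (by rw [abs_of_nonneg] <;> linarith)
  have h5 : 2 / Real.pi ^ 2 * g ^ 2 ≤ 2 / Real.pi ^ 2 * m ^ 2 := by gcongr
  have hn : 0 ≤ min r s := le_min hr hs
  have h6 : min r s * min r s ≤ r * s := mul_le_mul (min_le_left _ _) (min_le_right _ _) hn hr
  have h4 : 0 ≤ r * s := mul_nonneg hr hs
  have hq : 0 ≤ 2 / Real.pi ^ 2 * g ^ 2 := by positivity
  have key : (r - s) ^ 2 + (2 / Real.pi * (min r s * g)) ^ 2 ≤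
      r ^ 2 + s ^ 2 - 2 * r * s * Real.cos m := by
    have e : (2 / Real.pi * (min r s * g)) ^ 2
        = 2 * ((2 / Real.pi ^ 2 * g ^ 2) * (min r s * min r s)) := by
      field_simp
    rw [e]
    nlinarith [mul_le_mul_of_nonneg_left h6 hq,
      mul_le_mul_of_nonneg_left (show 2 / Real.pi ^ 2 * g ^ 2 ≤ 1 - Real.cos m by linarith) h4]
  have k1 : |r - s| ≤ Real.sqrt (r ^ 2 + s ^ 2 - 2 * r * s * Real.cos m) := by
    apply Real.abs_le_sqrt
    nlinarith [sq_nonneg (2 / Real.pi * (min r s * g))]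
  have k2 : 2 / Real.pi * (min r s * g) ≤
      Real.sqrt (r ^ 2 + s ^ 2 - 2 * r * s * Real.cos m) := by
    apply Real.le_sqrt_of_sq_le
    nlinarith [sq_nonneg (r - s)]
  have k3 : min r s * g = Real.pi / 2 * (2 / Real.pi * (min r s * g)) := by
    field_simp
  rw [k3]
  nlinarith

/-! ### The profile -/

lemma thetaMod_nonneg {l : ℝ} (hl : 0 < l) (θ : ℝ) : 0 ≤ thetaMod l θ := by
  unfold thetaMod
  have := Int.floor_le (θ / l)
  rw [le_div_iff₀ hl] at this
  linarith

lemma thetaMod_lt {l : ℝ} (hl : 0 < l) (θ : ℝ) : thetaMod l θ < l := by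
  unfold thetaMod
  have := Int.lt_floor_add_one (θ / l)
  rw [div_lt_iff₀ hl] at this
  linarith

lemma thetaMod_eq {l : ℝ} (hl : 0 < l) {θ : ℝ} (h0 : 0 ≤ θ) (h1 : θ < l) : thetaMod l θ = θ := by
  unfold thetaMod
  have : ⌊θ / l⌋ = 0 := by
    rw [Int.floor_eq_zero_iff]
    exact ⟨by positivity, by rwa [div_lt_one hl]⟩
  simp [this]

lemma thetaMod_add {l : ℝ} (hl : 0 < l) (θ : ℝ) : thetaMod l (θ + l) = thetaMod l θ := by
  unfold thetaMod
  have : (θ + l) / l = θ / l + 1 := by field_simp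
  rw [this, Int.floor_add_one]
  push_cast; ring

/-- The angular profile. -/
def prof (x : ℝ) : ℝ := Real.sin (min x Real.pi)

lemma prof_nonneg {x : ℝ} (hx : 0 ≤ x) : 0 ≤ prof x :=
  Real.sin_nonneg_of_nonneg_of_le_pi (le_min hx Real.pi_pos.le) (min_le_right _ _)

lemma prof_lip (x y : ℝ) : |prof x - prof y| ≤ |x - y| := by
  have h := Real.abs_sin_sub_sin_le (min x Real.pi) (min y Real.pi)
  have h2 := abs_min_sub_min_le_max x Real.pi y Real.pi
  simp at h2
  exact h.trans h2

lemma prof_of_le {x : ℝ} (h : Real.pi ≤ x) : prof x = 0 := by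
  unfold prof; rw [min_eq_right h, Real.sin_pi]

lemma uOnePhase_eq (l r θ : ℝ) : uOnePhase l r θ = r * prof (thetaMod l θ) := by
  unfold uOnePhase
  split_ifs with h
  · rw [prof, min_eq_left h]
  · rw [prof_of_le (not_le.1 h).le, mul_zero]

lemma prof_mod_lip {l : ℝ} (hl : 2 * Real.pi ≤ l) (θ φ : ℝ) (k : ℤ) :
    |prof (thetaMod l θ) - prof (thetaMod l φ)| ≤ |θ - φ + (k : ℝ) * l| := by
  have hp := Real.pi_pos
  have hl0 : 0 < l := by linarith
  have e : θ - φ + (k : ℝ) * l = thetaMod l θ - thetaMod l φ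
      + ((⌊θ / l⌋ - ⌊φ / l⌋ + k : ℤ) : ℝ) * l := by
    unfold thetaMod; push_cast; ring
  rw [e]
  generalize (⌊θ / l⌋ - ⌊φ / l⌋ + k) = j
  have hx0 := thetaMod_nonneg hl0 θ
  have hx1 := thetaMod_lt hl0 θ
  have hy0 := thetaMod_nonneg hl0 φ
  have hy1 := thetaMod_lt hl0 φ
  generalize thetaMod l θ = x at *
  generalize thetaMod l φ = y at *
  have hx2 := prof_nonneg hx0
  have hy2 := prof_nonneg hy0
  have p0 : prof 0 = 0 := by simp [prof, hp.le]
  have pl : prof l = 0 := prof_of_le (by linarith)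
  have a1 := prof_lip x 0
  have a2 := prof_lip y 0
  have a3 := prof_lip x l
  have a4 := prof_lip y l
  rw [p0, sub_zero, sub_zero, abs_of_nonneg hx2, abs_of_nonneg hx0] at a1
  rw [p0, sub_zero, sub_zero, abs_of_nonneg hy2, abs_of_nonneg hy0] at a2
  rw [pl, sub_zero, abs_of_nonneg hx2, abs_sub_comm, abs_of_nonneg (by linarith)] at a3
  rw [pl, sub_zero, abs_of_nonneg hy2, abs_sub_comm, abs_of_nonneg (by linarith)] at a4
  rcases lt_trichotomy j 0 with hj | hj | hj
  · have : (j : ℝ) ≤ -1 := by exact_mod_cast (by omega : j ≤ -1)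
    have h2 : (j : ℝ) * l ≤ -1 * l := by gcongr
    have h3 := neg_abs_le (x - y + (j : ℝ) * l)
    rw [abs_le]; constructor <;> linarith
  · subst hj; simpa using prof_lip x y
  · have : (1 : ℝ) ≤ j := by exact_mod_cast (by omega : 1 ≤ j)
    have h2 : 1 * l ≤ (j : ℝ) * l := by gcongr
    have h3 := le_abs_self (x - y + (j : ℝ) * l)
    rw [abs_le]; constructor <;> linarith

lemma prof_le_one (x : ℝ) : prof x ≤ 1 := Real.sin_le_one _

lemma coneLip_uOnePhase {l : ℝ} (hl : 2 * Real.pi ≤ l) : ConeLip l 1 (uOnePhase l) := by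
  have hp := Real.pi_pos
  have hl0 : 0 < l := by linarith
  refine ⟨fun r θ => by simp only [uOnePhase_eq, thetaMod_add hl0], 1 + Real.pi / 2, ?_⟩
  rintro ⟨r, θ⟩ ⟨s, φ⟩ ⟨hr, -⟩ ⟨hs, -⟩
  simp only at hr hs ⊢
  rw [uOnePhase_eq, uOnePhase_eq]
  have hx0 := prof_nonneg (thetaMod_nonneg hl0 θ)
  have hy0 := prof_nonneg (thetaMod_nonneg hl0 φ)
  have hx1 := prof_le_one (thetaMod l θ)
  have hy1 := prof_le_one (thetaMod l φ)
  refine le_trans ?_ (le_coneDist l r s θ φ |prof (thetaMod l θ) - prof (thetaMod l φ)| hr hs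
    (abs_nonneg _) (prof_mod_lip hl θ φ) (by rw [abs_le]; constructor <;> linarith))
  generalize prof (thetaMod l θ) = x at *
  generalize prof (thetaMod l φ) = y at *
  rcases le_total r s with h | h
  · rw [min_eq_left h]
    have : r * x - s * y = (r - s) * y + r * (x - y) := by ring
    rw [this]
    refine (abs_add_le _ _).trans ?_
    rw [abs_mul, abs_mul, abs_of_nonneg hr, abs_of_nonneg hy0]
    nlinarith [abs_nonneg (r - s)]
  · rw [min_eq_right h]
    have : r * x - s * y = (r - s) * x + s * (x - y) := by ring
    rw [this]
    refine (abs_add_le _ _).trans ?_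
    rw [abs_mul, abs_mul, abs_of_nonneg hs, abs_of_nonneg hx0]
    nlinarith [abs_nonneg (r - s)]

/-! ### The energy of the profile -/

lemma integral_theta_pi {l : ℝ} (hl : 2 * Real.pi ≤ l) :
    ∫ θ in Ioo (0:ℝ) l, (if θ < Real.pi then (1:ℝ) else 0) = Real.pi := by
  have hp := Real.pi_pos
  have h1 : (fun θ : ℝ => if θ < Real.pi then (1:ℝ) else 0) = (Iio Real.pi).indicator 1 := by
    ext θ; simp [indicator_apply]
  rw [h1, setIntegral_indicator measurableSet_Iio]
  have : Ioo (0:ℝ) l ∩ Iio Real.pi = Ioo 0 Real.pi := by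
    ext x; simp only [mem_inter_iff, mem_Ioo, mem_Iio]; constructor
    · rintro ⟨⟨a, b⟩, c⟩; exact ⟨a, c⟩
    · rintro ⟨a, b⟩; exact ⟨⟨a, by linarith⟩, b⟩
  rw [this]
  simp [hp.le]

lemma uOnePhase_deriv_r (l θ r : ℝ) :
    deriv (fun s => uOnePhase l s θ) r = prof (thetaMod l θ) := by
  simp only [uOnePhase_eq]
  simp

lemma integrand_uOnePhase {l : ℝ} (hl : 2 * Real.pi ≤ l) {p : ℝ × ℝ}
    (hp : p ∈ Ioo (0:ℝ) 1 ×ˢ Ioo (0:ℝ) l) :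
    (gradSq (uOnePhase l) p + (if 0 < uOnePhase l p.1 p.2 then (1:ℝ) else 0)
      + (if uOnePhase l p.1 p.2 < 0 then (0:ℝ) else 0)) * p.1
      = (2 * p.1) * (if p.2 < Real.pi then (1:ℝ) else 0) := by
  have hpi := Real.pi_pos
  have hl0 : 0 < l := by linarith
  obtain ⟨r, θ⟩ := p
  obtain ⟨⟨hr0, hr1⟩, ⟨ht0, ht1⟩⟩ := hp
  simp only at *
  unfold gradSq
  simp only [uOnePhase_deriv_r, thetaMod_eq hl0 ht0.le ht1]
  by_cases h : θ < Real.pi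
  · have hu : uOnePhase l r θ = r * Real.sin θ := by
      rw [uOnePhase_eq, thetaMod_eq hl0 ht0.le ht1, prof, min_eq_left h.le]
    have hd : deriv (fun φ => uOnePhase l r φ) θ = r * Real.cos θ := by
      have : (fun φ => uOnePhase l r φ) =ᶠ[𝓝 θ] fun φ => r * Real.sin φ := by
        filter_upwards [Ioo_mem_nhds ht0 h] with φ hφ
        rw [uOnePhase_eq, thetaMod_eq hl0 hφ.1.le (by linarith [hφ.2]), prof,
          min_eq_left hφ.2.le]
      rw [this.deriv_eq]
      simp
    have hpos : 0 < r * Real.sin θ := mul_pos hr0 (Real.sin_pos_of_pos_of_lt_pi ht0 h)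
    rw [hu, hd, if_pos hpos, if_pos h, prof, min_eq_left h.le]
    have := Real.sin_sq_add_cos_sq θ
    have e : (r * Real.cos θ) ^ 2 / r ^ 2 = Real.cos θ ^ 2 := by field_simp
    rw [e, this]
    simp only [ite_self]; ring
  · have h' := not_lt.1 h
    have hu : uOnePhase l r θ = 0 := by
      rw [uOnePhase_eq, thetaMod_eq hl0 ht0.le ht1, prof_of_le h', mul_zero]
    have hd : deriv (fun φ => uOnePhase l r φ) θ = 0 := by
      apply IsLocalMin.deriv_eq_zero
      refine Eventually.of_forall fun φ => ?_
      simp only [hu]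
      rw [uOnePhase_eq]
      exact mul_nonneg hr0.le (prof_nonneg (thetaMod_nonneg hl0 _))
    rw [hu, hd, if_neg h, prof_of_le h']
    simp

lemma Jfun_uOnePhase {l : ℝ} (hl : 2 * Real.pi ≤ l) : Jfun l 1 0 (uOnePhase l) 1 = Real.pi := by
  unfold Jfun
  rw [setIntegral_congr_fun (measurableSet_Ioo.prod measurableSet_Ioo)
    (fun p hp => integrand_uOnePhase hl hp)]
  rw [Measure.volume_eq_prod, setIntegral_prod_mul (fun r : ℝ => 2 * r)
    (fun θ : ℝ => if θ < Real.pi then (1:ℝ) else 0), integral_theta_pi hl]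
  have : ∫ x in Ioo (0:ℝ) 1, 2 * x = 1 := by
    rw [← integral_Ioc_eq_integral_Ioo, ← intervalIntegral.integral_of_le zero_le_one]
    rw [intervalIntegral.integral_const_mul, integral_id]; norm_num
  rw [this, one_mul]

/-! ### Competitors -/

/-- Clamping of the radius to `[0,1]`. -/
def cl (r : ℝ) : ℝ := max 0 (min r 1)

lemma cl_mem (r : ℝ) : cl r ∈ Icc (0:ℝ) 1 :=
  ⟨le_max_left _ _, max_le zero_le_one (min_le_right _ _)⟩

lemma cl_of_mem {r : ℝ} (h : r ∈ Icc (0:ℝ) 1) : cl r = r := by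
  unfold cl; rw [min_eq_left h.2, max_eq_right h.1]

lemma cl_lip (r s : ℝ) : |cl r - cl s| ≤ |r - s| := by
  have h1 := abs_max_sub_max_le_max 0 (min r 1) 0 (min s 1)
  have h2 := abs_min_sub_min_le_max r 1 s 1
  simp at h1 h2
  exact h1.trans h2

/-- Globally defined Lipschitz functions in polar coordinates. -/
structure Good (l K : ℝ) (W : ℝ → ℝ → ℝ) : Prop where
  K0 : 0 ≤ K
  lr : ∀ r s θ, |W r θ - W s θ| ≤ K * |r - s|
  lt : ∀ r θ φ, |W r θ - W r φ| ≤ K * cl r * |θ - φ|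
  per : ∀ r θ, W r (θ + l) = W r θ

lemma good_of_coneLip {l : ℝ} {w : ℝ → ℝ → ℝ} (h : ConeLip l 1 w) :
    ∃ K, Good l K (fun r θ => w (cl r) θ) := by
  obtain ⟨hper, K, hK⟩ := h
  have hK' : ∀ r s θ φ, |w (cl r) θ - w (cl s) φ| ≤
      |K| * Real.sqrt ((cl r - cl s) ^ 2 + cl r * cl s * (θ - φ) ^ 2) := by
    intro r s θ φ
    refine (hK (cl r, θ) (cl s, φ) (cl_mem r) (cl_mem s)).trans ?_
    have h1 := coneDist_le l (cl r) (cl s) θ φ (cl_mem r).1 (cl_mem s).1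
    have h0 : 0 ≤ coneDist l (cl r, θ) (cl s, φ) := Real.sqrt_nonneg _
    exact mul_le_mul (le_abs_self K) h1 h0 (abs_nonneg _)
  refine ⟨|K|, abs_nonneg _, fun r s θ => ?_, fun r θ φ => ?_, fun r θ => hper _ _⟩
  · refine (hK' r s θ θ).trans ?_
    have : (cl r - cl s) ^ 2 + cl r * cl s * (θ - θ) ^ 2 = (cl r - cl s) ^ 2 := by ring
    rw [this, Real.sqrt_sq_eq_abs]
    exact mul_le_mul_of_nonneg_left (cl_lip r s) (abs_nonneg _)
  · refine (hK' r r θ φ).trans ?_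
    have : (cl r - cl r) ^ 2 + cl r * cl r * (θ - φ) ^ 2 = (cl r * (θ - φ)) ^ 2 := by ring
    rw [this, Real.sqrt_sq_eq_abs, abs_mul, abs_of_nonneg (cl_mem r).1, mul_assoc]

lemma Good.pos {l K : ℝ} {W : ℝ → ℝ → ℝ} (h : Good l K W) :
    Good l K (fun r θ => max (W r θ) 0) := by
  have key : ∀ x y : ℝ, |max x 0 - max y 0| ≤ |x - y| := fun x y => by
    have := abs_max_sub_max_le_max x 0 y 0
    simpa using this
  exact ⟨h.K0, fun r s θ => (key _ _).trans (h.lr r s θ),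
    fun r θ φ => (key _ _).trans (h.lt r θ φ), fun r θ => by simp only [h.per]⟩

section good
variable {l K : ℝ} {W : ℝ → ℝ → ℝ}

lemma Good.lipr (h : Good l K W) (θ : ℝ) : LipschitzWith K.toNNReal (fun r => W r θ) :=
  LipschitzWith.of_dist_le_mul fun r s => by
    rw [Real.dist_eq, Real.dist_eq, Real.coe_toNNReal _ h.K0]; exact h.lr r s θ

lemma Good.lipt (h : Good l K W) (r : ℝ) : LipschitzWith K.toNNReal (fun θ => W r θ) :=
  LipschitzWith.of_dist_le_mul fun θ φ => by
    rw [Real.dist_eq, Real.dist_eq, Real.coe_toNNReal _ h.K0]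
    refine (h.lt r θ φ).trans ?_
    have := (cl_mem r).2
    have := h.K0
    gcongr
    nlinarith

lemma Good.cont (h : Good l K W) : Continuous (Function.uncurry W) :=
  continuous_prod_of_continuous_lipschitzWith _ K.toNNReal
    (fun r => (h.lipt r).continuous) (fun θ => h.lipr θ)

lemma Good.dr_le (h : Good l K W) (r θ : ℝ) : |deriv (fun s => W s θ) r| ≤ K := by
  rw [← Real.norm_eq_abs]
  exact norm_deriv_le_of_lip' h.K0 (Eventually.of_forall fun s => h.lr s r θ)

lemma Good.dt_le (h : Good l K W) (r θ : ℝ) : |deriv (fun φ => W r φ) θ| ≤ K * cl r := by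
  rw [← Real.norm_eq_abs]
  exact norm_deriv_le_of_lip' (mul_nonneg h.K0 (cl_mem r).1)
    (Eventually.of_forall fun s => h.lt r s θ)

lemma Good.meas_dr (h : Good l K W) :
    Measurable fun p : ℝ × ℝ => deriv (fun s => W s p.2) p.1 := by
  have : Continuous (Function.uncurry fun θ s => W s θ) := h.cont.comp continuous_swap
  exact (measurable_deriv_with_param this).comp measurable_swap

lemma Good.meas_dt (h : Good l K W) :
    Measurable fun p : ℝ × ℝ => deriv (fun φ => W p.1 φ) p.2 :=
  measurable_deriv_with_param h.cont

lemma Good.meas_gradSq (h : Good l K W) : Measurable (gradSq W) := by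
  unfold gradSq
  exact (h.meas_dr.pow_const 2).add ((h.meas_dt.pow_const 2).div (measurable_fst.pow_const 2))

lemma Good.gradSq_le (h : Good l K W) {p : ℝ × ℝ} (hp : p.1 ∈ Ioo (0:ℝ) 1) :
    gradSq W p ≤ 2 * K ^ 2 := by
  unfold gradSq
  have h1 := h.dr_le p.1 p.2
  have h2 := h.dt_le p.1 p.2
  rw [cl_of_mem ⟨hp.1.le, hp.2.le⟩] at h2
  have h3 : (deriv (fun s => W s p.2) p.1) ^ 2 ≤ K ^ 2 := by
    rw [← sq_abs]; gcongr
  have h4 : (deriv (fun φ => W p.1 φ) p.2) ^ 2 ≤ (K * p.1) ^ 2 := by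
    rw [← sq_abs]; gcongr
  have h5 : (deriv (fun φ => W p.1 φ) p.2) ^ 2 / p.1 ^ 2 ≤ K ^ 2 := by
    rw [div_le_iff₀ (pow_pos hp.1 2)]
    linarith [mul_pow K p.1 2]
  linarith

lemma gradSq_nonneg (W : ℝ → ℝ → ℝ) (p : ℝ × ℝ) : 0 ≤ gradSq W p := by
  unfold gradSq; positivity

lemma vol_fin (l : ℝ) : volume (Ioo (0:ℝ) 1 ×ˢ Ioo (0:ℝ) l) < ⊤ := by
  rw [Measure.volume_eq_prod, Measure.prod_prod]
  exact ENNReal.mul_lt_top (by simp) (by simp)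

lemma Good.integrable_J (h : Good l K W) :
    IntegrableOn (fun p : ℝ × ℝ => (gradSq W p + (if 0 < W p.1 p.2 then (1:ℝ) else 0)
      + (if W p.1 p.2 < 0 then (0:ℝ) else 0)) * p.1) (Ioo (0:ℝ) 1 ×ˢ Ioo (0:ℝ) l) := by
  have hm : MeasurableSet {p : ℝ × ℝ | 0 < W p.1 p.2} :=
    measurableSet_lt measurable_const h.cont.measurable
  refine IntegrableOn.of_bound (vol_fin l) ?_ (2 * K ^ 2 + 1) ?_
  · apply Measurable.aestronglyMeasurable
    simp only [ite_self, add_zero]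
    exact (h.meas_gradSq.add (Measurable.ite hm measurable_const measurable_const)).mul
      measurable_fst
  · refine ae_restrict_of_forall_mem (measurableSet_Ioo.prod measurableSet_Ioo) fun p hp => ?_
    have h1 := h.gradSq_le hp.1
    have h0 := gradSq_nonneg W p
    have h2 : 0 ≤ (if 0 < W p.1 p.2 then (1:ℝ) else 0) := by split_ifs <;> norm_num
    have h3 : (if 0 < W p.1 p.2 then (1:ℝ) else 0) ≤ 1 := by split_ifs <;> norm_num
    simp only [ite_self, add_zero]
    rw [Real.norm_eq_abs, abs_mul, abs_of_nonneg (by linarith), abs_of_pos hp.1.1]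
    nlinarith [hp.1.1, hp.1.2]

end good

/-- The pointwise calibration inequality. -/
lemma Good.pointwise {l K : ℝ} {W : ℝ → ℝ → ℝ} (h : Good l K W) {p : ℝ × ℝ} (hp : 0 < p.1)
    (t : ℝ) :
    2 * (Real.sin t * deriv (fun s => max (W s p.2) 0) p.1 * p.1
      + Real.cos t * deriv (fun φ => max (W p.1 φ) 0) p.2) ≤
    (gradSq W p + (if 0 < W p.1 p.2 then (1:ℝ) else 0)
      + (if W p.1 p.2 < 0 then (0:ℝ) else 0)) * p.1 := by
  obtain ⟨r, θ⟩ := p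
  simp only [ite_self, add_zero] at *
  by_cases hW : 0 < W r θ
  · have e1 : deriv (fun s => max (W s θ) 0) r = deriv (fun s => W s θ) r := by
      apply Filter.EventuallyEq.deriv_eq
      filter_upwards [(h.lipr θ).continuous.continuousAt.eventually (lt_mem_nhds hW)] with s hs
      exact max_eq_left hs.le
    have e2 : deriv (fun φ => max (W r φ) 0) θ = deriv (fun φ => W r φ) θ := by
      apply Filter.EventuallyEq.deriv_eq
      filter_upwards [(h.lipt r).continuous.continuousAt.eventually (lt_mem_nhds hW)] with s hs
      exact max_eq_left hs.le
    rw [e1, e2, if_pos hW]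
    unfold gradSq
    simp only
    generalize deriv (fun s => W s θ) r = x
    generalize deriv (fun φ => W r φ) θ = y
    have : y = (y / r) * r := by field_simp
    have e3 : y ^ 2 / r ^ 2 = (y / r) ^ 2 := by ring
    rw [e3]
    generalize y / r = z at *
    subst this
    have hk : 2 * (Real.sin t * x + Real.cos t * z) ≤ x ^ 2 + z ^ 2 + 1 := by
      nlinarith [Real.sin_sq_add_cos_sq t, sq_nonneg (x - Real.sin t), sq_nonneg (z - Real.cos t)]
    nlinarith [mul_le_mul_of_nonneg_right hk hp.le]
  · have hW' : max (W r θ) 0 = 0 := max_eq_right (not_lt.1 hW)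
    have e1 : deriv (fun s => max (W s θ) 0) r = 0 := by
      apply IsLocalMin.deriv_eq_zero
      refine Eventually.of_forall fun s => ?_
      simp only [hW']; exact le_max_right _ _
    have e2 : deriv (fun φ => max (W r φ) 0) θ = 0 := by
      apply IsLocalMin.deriv_eq_zero
      refine Eventually.of_forall fun s => ?_
      simp only [hW']; exact le_max_right _ _
    rw [e1, e2, if_neg hW]
    have := gradSq_nonneg W (r, θ)
    simp only [mul_zero, zero_mul, add_zero]
    positivity

/-! ### The calibration -/

/-- The angle of the calibrating field. -/
def bet (l θ : ℝ) : ℝ := min θ (3 * Real.pi / 2) + max (θ - (l - Real.pi / 2)) 0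

lemma bet_cont (l : ℝ) : Continuous (bet l) := by unfold bet; fun_prop

lemma bet_lip {l : ℝ} (hl : 2 * Real.pi ≤ l) (x y : ℝ) : |bet l x - bet l y| ≤ |x - y| := by
  unfold bet
  rcases le_total x (3 * Real.pi / 2) with h1 | h1 <;>
  rcases le_total y (3 * Real.pi / 2) with h2 | h2 <;>
  rcases le_total (x - (l - Real.pi / 2)) 0 with h3 | h3 <;>
  rcases le_total (y - (l - Real.pi / 2)) 0 with h4 | h4 <;>
  simp only [h1, h2, h3, h4, min_eq_left, min_eq_right, max_eq_left, max_eq_right] <;>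
  rw [abs_le] <;> constructor <;>
  linarith [le_abs_self (x - y), neg_abs_le (x - y), abs_nonneg (x - y)]

lemma cosbet_lip {l : ℝ} (hl : 2 * Real.pi ≤ l) :
    LipschitzWith 1 (fun θ => Real.cos (bet l θ)) :=
  LipschitzWith.of_dist_le_mul fun x y => by
    rw [Real.dist_eq, Real.dist_eq]
    have := (Real.abs_cos_sub_cos_le (bet l x) (bet l y)).trans (bet_lip hl x y)
    simpa using this

lemma sin_three_pi_div_two : Real.sin (3 * Real.pi / 2) = -1 := by
  have : 3 * Real.pi / 2 = Real.pi / 2 + Real.pi := by ring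
  rw [this, Real.sin_add_pi, Real.sin_pi_div_two]

/-- The calibrating field has nonpositive divergence. -/
lemma div_le {l : ℝ} (hl : 2 * Real.pi ≤ l) (θ : ℝ) :
    Real.sin (bet l θ) + deriv (fun θ => Real.cos (bet l θ)) θ ≤ 0 := by
  rcases lt_or_ge θ (3 * Real.pi / 2) with h1 | h1
  · have e : (fun θ => Real.cos (bet l θ)) =ᶠ[𝓝 θ] Real.cos := by
      filter_upwards [gt_mem_nhds h1] with x hx
      rw [bet, min_eq_left hx.le, max_eq_right (by linarith), add_zero]
    rw [e.deriv_eq, Real.deriv_cos, bet, min_eq_left h1.le, max_eq_right (by linarith)]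
    simp
  rcases lt_or_ge (l - Real.pi / 2) θ with h2 | h2
  · have e : (fun θ => Real.cos (bet l θ)) =ᶠ[𝓝 θ] fun x => Real.cos (x - l) := by
      filter_upwards [lt_mem_nhds h2] with x hx
      rw [bet, min_eq_right (by linarith), max_eq_left (by linarith), ← Real.cos_add_two_pi (x - l)]
      congr 1; ring
    rw [e.deriv_eq, bet, min_eq_right (by linarith), max_eq_left (by linarith),
      deriv_comp_sub_const, Real.deriv_cos, ← Real.sin_add_two_pi (θ - l)]
    have : 3 * Real.pi / 2 + (θ - (l - Real.pi / 2)) = θ - l + 2 * Real.pi := by ring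
    rw [this]; simp
  · have e : bet l θ = 3 * Real.pi / 2 := by
      rw [bet, min_eq_right h1, max_eq_right (by linarith), add_zero]
    rw [e, sin_three_pi_div_two]
    have := norm_deriv_le_of_lipschitz (x₀ := θ) (cosbet_lip hl)
    rw [Real.norm_eq_abs] at this
    have := (le_abs_self _).trans this
    simp at this
    linarith

lemma ac_of_lip {K : NNReal} {f : ℝ → ℝ} (h : LipschitzWith K f) (a b : ℝ) :
    AbsolutelyContinuousOnInterval f a b := (h.lipschitzOnWith).absolutelyContinuousOnInterval

lemma Good.theta_int {l K : ℝ} (hl : 2 * Real.pi ≤ l) {P : ℝ → ℝ → ℝ} (h : Good l K P)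
    (h0 : ∀ r θ, 0 ≤ P r θ) (r : ℝ) :
    ∫ θ in Ioo 0 l, Real.sin (bet l θ) * P r θ ≤
      ∫ θ in Ioo 0 l, Real.cos (bet l θ) * deriv (fun φ => P r φ) θ := by
  have hp := Real.pi_pos
  have hl0 : 0 ≤ l := by linarith
  have hb := ac_of_lip (cosbet_lip hl) 0 l
  have hP := ac_of_lip (h.lipt r) 0 l
  simp only [← integral_Ioc_eq_integral_Ioo, ← intervalIntegral.integral_of_le hl0]
  rw [hb.integral_mul_deriv_eq_deriv_mul hP]
  have b0 : Real.cos (bet l 0) = 1 := by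
    rw [bet, min_eq_left (by positivity), max_eq_right (by linarith)]; simp
  have bl : Real.cos (bet l l) = 1 := by
    rw [bet, min_eq_right (by linarith), max_eq_left (by linarith), ← Real.cos_two_pi]
    congr 1; ring
  have pl : P r l = P r 0 := by simpa using h.per r 0
  rw [b0, bl, pl, sub_self, zero_sub, ← intervalIntegral.integral_neg]
  have hPc : Continuous (P r) := (h.lipt r).continuous
  apply intervalIntegral.integral_mono_on hl0
  · exact ((Real.continuous_sin.comp (bet_cont l)).mul hPc).intervalIntegrable _ _
  · exact (hb.intervalIntegrable_deriv.mul_continuousOn hPc.continuousOn).neg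
  · intro θ _
    nlinarith [mul_nonneg (neg_nonneg.2 (div_le hl θ)) (h0 r θ)]

lemma Good.r_int {l K : ℝ} {P : ℝ → ℝ → ℝ} (h : Good l K P) (θ : ℝ) :
    ∫ r in Ioo (0:ℝ) 1, deriv (fun s => P s θ) r * r = P 1 θ - ∫ r in Ioo (0:ℝ) 1, P r θ := by
  have hP := ac_of_lip (h.lipr θ) 0 1
  have hb := ac_of_lip (LipschitzWith.id (α := ℝ)) 0 1
  simp only [← integral_Ioc_eq_integral_Ioo, ← intervalIntegral.integral_of_le zero_le_one]
  have := hb.integral_mul_deriv_eq_deriv_mul hP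
  simp at this
  rw [← this]
  simp [mul_comm]

lemma Good.calib {l K : ℝ} (hl : 2 * Real.pi ≤ l) {P : ℝ → ℝ → ℝ} (h : Good l K P)
    (h0 : ∀ r θ, 0 ≤ P r θ) :
    IntegrableOn (fun p : ℝ × ℝ => Real.sin (bet l p.2) * deriv (fun s => P s p.2) p.1 * p.1
      + Real.cos (bet l p.2) * deriv (fun φ => P p.1 φ) p.2) (Ioo (0:ℝ) 1 ×ˢ Ioo (0:ℝ) l) ∧
    ∫ θ in Ioo 0 l, Real.sin (bet l θ) * P 1 θ ≤
    ∫ p in Ioo (0:ℝ) 1 ×ˢ Ioo (0:ℝ) l,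
      (Real.sin (bet l p.2) * deriv (fun s => P s p.2) p.1 * p.1
      + Real.cos (bet l p.2) * deriv (fun φ => P p.1 φ) p.2) := by
  have hms := (measurableSet_Ioo (a := (0:ℝ)) (b := 1)).prod (measurableSet_Ioo (a := (0:ℝ)) (b := l))
  have cs : Continuous fun θ => Real.sin (bet l θ) := Real.continuous_sin.comp (bet_cont l)
  have cc : Continuous fun θ => Real.cos (bet l θ) := Real.continuous_cos.comp (bet_cont l)
  have i1 : IntegrableOn (fun p : ℝ × ℝ => Real.sin (bet l p.2) * deriv (fun s => P s p.2) p.1 * p.1)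
      (Ioo (0:ℝ) 1 ×ˢ Ioo (0:ℝ) l) := by
    refine IntegrableOn.of_bound (vol_fin l) ?_ (1 * K * 1) ?_
    · exact (((cs.measurable.comp measurable_snd).mul h.meas_dr).mul
        measurable_fst).aestronglyMeasurable
    · refine ae_restrict_of_forall_mem hms fun p hp => ?_
      rw [Real.norm_eq_abs, abs_mul, abs_mul, abs_of_pos hp.1.1]
      have := h.dr_le p.1 p.2
      have := Real.abs_sin_le_one (bet l p.2)
      have := hp.1.1
      have := hp.1.2
      have := h.K0
      gcongr
  have i2 : IntegrableOn (fun p : ℝ × ℝ => Real.cos (bet l p.2) * deriv (fun φ => P p.1 φ) p.2)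
      (Ioo (0:ℝ) 1 ×ˢ Ioo (0:ℝ) l) := by
    refine IntegrableOn.of_bound (vol_fin l) ?_ (1 * (K * 1)) ?_
    · exact ((cc.measurable.comp measurable_snd).mul h.meas_dt).aestronglyMeasurable
    · refine ae_restrict_of_forall_mem hms fun p hp => ?_
      rw [Real.norm_eq_abs, abs_mul]
      have := h.K0
      have h3 := (h.dt_le p.1 p.2).trans (mul_le_mul_of_nonneg_left (cl_mem p.1).2 h.K0)
      have := Real.abs_cos_le_one (bet l p.2)
      gcongr
  have i3 : IntegrableOn (fun p : ℝ × ℝ => Real.sin (bet l p.2) * P p.1 p.2)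
      (Ioo (0:ℝ) 1 ×ˢ Ioo (0:ℝ) l) := by
    have : Continuous (fun p : ℝ × ℝ => Real.sin (bet l p.2) * P p.1 p.2) :=
      (cs.comp continuous_snd).mul h.cont
    refine (this.continuousOn.integrableOn_compact
      (isCompact_Icc.prod isCompact_Icc)).mono_set
        (prod_mono Ioo_subset_Icc_self Ioo_subset_Icc_self : _ ⊆ Icc (0:ℝ) 1 ×ˢ Icc (0:ℝ) l)
  refine ⟨i1.add i2, ?_⟩
  rw [integral_add i1 i2]
  simp only [IntegrableOn, Measure.volume_eq_prod, ← Measure.prod_restrict] at i1 i2 i3 ⊢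
  rw [integral_prod_symm _ i1, integral_prod _ i2]
  have j2 : ∫ r in Ioo (0:ℝ) 1, ∫ θ in Ioo 0 l, Real.sin (bet l θ) * P r θ ≤
      ∫ r in Ioo (0:ℝ) 1, ∫ θ in Ioo 0 l, Real.cos (bet l θ) * deriv (fun φ => P r φ) θ :=
    integral_mono i3.integral_prod_left i2.integral_prod_left fun r => h.theta_int hl h0 r
  have j3 : ∫ r in Ioo (0:ℝ) 1, ∫ θ in Ioo 0 l, Real.sin (bet l θ) * P r θ
      = ∫ θ in Ioo 0 l, ∫ r in Ioo (0:ℝ) 1, Real.sin (bet l θ) * P r θ := by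
    rw [← integral_prod _ i3, integral_prod_symm _ i3]
  have j1 : ∫ θ in Ioo 0 l, ∫ r in Ioo (0:ℝ) 1, Real.sin (bet l θ) * deriv (fun s => P s θ) r * r
      = (∫ θ in Ioo 0 l, Real.sin (bet l θ) * P 1 θ)
        - ∫ θ in Ioo 0 l, ∫ r in Ioo (0:ℝ) 1, Real.sin (bet l θ) * P r θ := by
    rw [← integral_sub _ i3.integral_prod_right]
    · congr 1; ext θ
      simp only [mul_assoc]
      rw [integral_const_mul, integral_const_mul, h.r_int θ]; ring
    · have : Continuous (fun θ => Real.sin (bet l θ) * P 1 θ) := cs.mul (h.lipt 1).continuous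
      exact (this.continuousOn.integrableOn_compact isCompact_Icc).mono_set Ioo_subset_Icc_self
  rw [j1]
  linarith

lemma boundary_int {l : ℝ} (hl : 2 * Real.pi ≤ l) :
    ∫ θ in Ioo 0 l, Real.sin (bet l θ) * max (uOnePhase l 1 θ) 0 = Real.pi / 2 := by
  have hp := Real.pi_pos
  have hl0 : 0 < l := by linarith
  have e : ∀ θ ∈ Ioo 0 l, Real.sin (bet l θ) * max (uOnePhase l 1 θ) 0
      = (Ioc 0 Real.pi).indicator (fun θ => Real.sin θ ^ 2) θ := by
    intro θ hθ
    rw [uOnePhase_eq, thetaMod_eq hl0 hθ.1.le hθ.2, one_mul, max_eq_left (prof_nonneg hθ.1.le)]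
    by_cases h : θ ≤ Real.pi
    · rw [indicator_of_mem (show θ ∈ Ioc 0 Real.pi from ⟨hθ.1, h⟩), prof, min_eq_left h, bet,
        min_eq_left (by linarith), max_eq_right (by linarith), add_zero, sq]
    · rw [indicator_of_notMem (fun h' => h h'.2), prof_of_le (not_le.1 h).le, mul_zero]
  rw [setIntegral_congr_fun measurableSet_Ioo e, setIntegral_indicator measurableSet_Ioc]
  have : Ioo (0:ℝ) l ∩ Ioc 0 Real.pi = Ioc 0 Real.pi := by
    rw [inter_eq_right]
    intro x hx
    exact ⟨hx.1, by linarith [hx.2]⟩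
  rw [this, ← intervalIntegral.integral_of_le hp.le, integral_sin_sq]
  simp

lemma Jfun_ge {l : ℝ} (hl : 2 * Real.pi ≤ l) {w : ℝ → ℝ → ℝ} (hw : ConeLip l 1 w)
    (hb : ∀ θ, w 1 θ = uOnePhase l 1 θ) : Real.pi ≤ Jfun l 1 0 w 1 := by
  obtain ⟨K, h⟩ := good_of_coneLip hw
  set W : ℝ → ℝ → ℝ := fun r θ => w (cl r) θ with hW
  have hms := (measurableSet_Ioo (a := (0:ℝ)) (b := 1)).prod (measurableSet_Ioo (a := (0:ℝ)) (b := l))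
  have e : Jfun l 1 0 w 1 = Jfun l 1 0 W 1 := by
    unfold Jfun
    refine setIntegral_congr_fun hms fun p hp => ?_
    have c : ∀ s ∈ Ioo (0:ℝ) 1, cl s = s := fun s hs => cl_of_mem ⟨hs.1.le, hs.2.le⟩
    have e1 : w p.1 = W p.1 := by simp only [hW]; rw [c p.1 hp.1]
    have e2 : deriv (fun s => w s p.2) p.1 = deriv (fun s => W s p.2) p.1 := by
      apply Filter.EventuallyEq.deriv_eq
      filter_upwards [Ioo_mem_nhds hp.1.1 hp.1.2] with s hs
      simp only [hW]; rw [c s hs]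
    simp only [gradSq, e2, e1]
  rw [e]
  obtain ⟨hi, hc⟩ := h.pos.calib hl (fun r θ => le_max_right _ _)
  have w1 : ∀ θ, W 1 θ = uOnePhase l 1 θ := fun θ => by
    simp only [hW]; rw [cl_of_mem ⟨zero_le_one, le_rfl⟩, hb]
  simp only [w1] at hc
  rw [boundary_int hl] at hc
  have hm := setIntegral_mono_on (hi.const_mul 2) h.integrable_J hms
    (fun p hp => h.pointwise hp.1.1 (bet l p.2))
  rw [integral_const_mul] at hm
  unfold Jfun
  linarith

/-- On a cone of length `l ≥ 2π`, the profile `u(r,θ) = r sin θ` on `θ ∈ [0,π]`,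
vanishing elsewhere, is a minimizer of `J(C_1, 1, 0)`. In particular the free boundary
of this minimizer passes through the vertex. -/
theorem one_phase_through_vertex (l : ℝ) (hl : 2 * Real.pi ≤ l) :
    IsMinimizerJ l 1 0 1 (uOnePhase l) := by
  refine ⟨coneLip_uOnePhase hl, fun w hw hb => ?_⟩
  rw [Jfun_uOnePhase hl]
  exact Jfun_ge hl hw hb
end
end

section
/- Let l > 0 and λ₊, λ₋ ≥ 0, and let u be a minimizer of J(C_1, λ₊, λ₋) on the cone of length l with u(0) = 0 at the vertex. For r ∈ (0,1) define the Weiss energy W(r) = r^{−2} J(u, C_r) − r^{−1} ∫₀^r ∫₀^l (∂_t u(t, θ))² dθ dt. Then W is nondecreasing on (0,1). Moreover, for 0 < r₁ < r₂ < 1, W(r₁) = W(r₂) if and only if u is homogeneous of degree 1 on the annulus {r₁ ≤ r ≤ r₂}, i.e. u(s, θ) = s · u(r₂, θ)/r₂ for all s ∈ [r₁, r₂] and all θ. -/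
open MeasureTheory Set

noncomputable section

/-- The Weiss energy
`W(r) = r^{−2} J(u, C_r) − r^{−1} ∫₀^r ∫₀^l (∂_t u(t, θ))² dθ dt`. -/
def Weiss (l lp lm : ℝ) (u : ℝ → ℝ → ℝ) (r : ℝ) : ℝ :=
  (1 / r ^ 2) * Jfun l lp lm u r -
    (1 / r) * ∫ p in Set.Ioo (0:ℝ) r ×ˢ Set.Ioo (0:ℝ) l,
      (deriv (fun s => u s p.2) p.1) ^ 2


/-- Polar form of the cone Lipschitz condition on the unit cone ball. -/
structure PLK (l K : ℝ) (v : ℝ → ℝ → ℝ) : Prop where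
  per : ∀ r θ : ℝ, v r (θ + l) = v r θ
  nonneg : 0 ≤ K
  rad : ∀ r ∈ Icc (0:ℝ) 1, ∀ s ∈ Icc (0:ℝ) 1, ∀ θ, |v r θ - v s θ| ≤ K * |r - s|
  ang : ∀ r ∈ Icc (0:ℝ) 1, ∀ θ φ, |v r θ - v r φ| ≤ K * (r * |θ - φ|)

def PL (l : ℝ) (v : ℝ → ℝ → ℝ) : Prop := ∃ K, PLK l K v

lemma angle_bdd (l a : ℝ) : BddBelow (range fun k : ℤ => |a + (k:ℝ) * l|) :=
  ⟨0, by rintro _ ⟨k, rfl⟩; positivity⟩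

lemma coneDist_rad (l r s θ : ℝ) : coneDist l (r, θ) (s, θ) = |r - s| := by
  have h0 : (⨅ k : ℤ, |θ - θ + (k:ℝ) * l|) = 0 := by
    apply le_antisymm
    · refine (ciInf_le (angle_bdd l _) 0).trans ?_
      simp
    · exact le_ciInf fun k => abs_nonneg _
  unfold coneDist
  simp only [h0]
  rw [min_eq_left Real.pi_pos.le, Real.cos_zero, ← Real.sqrt_sq_eq_abs]
  congr 1; ring

lemma coneDist_ang (l r θ φ : ℝ) (hr : 0 ≤ r) : coneDist l (r, θ) (r, φ) ≤ r * |θ - φ| := by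
  unfold coneDist
  simp only
  set x := min (⨅ k : ℤ, |θ - φ + (k:ℝ) * l|) Real.pi with hx
  have hx0 : 0 ≤ x := le_min (le_ciInf fun k => abs_nonneg _) Real.pi_pos.le
  have hx1 : x ≤ |θ - φ| := by
    refine (min_le_left _ _).trans ((ciInf_le (angle_bdd l _) 0).trans ?_)
    simp
  have hc := Real.one_sub_sq_div_two_le_cos (x := x)
  have hxx : x ^ 2 ≤ |θ - φ| ^ 2 := by gcongr
  rw [Real.sqrt_le_left (by positivity)]
  nlinarith [sq_nonneg r, mul_le_mul_of_nonneg_left hc (sq_nonneg r), mul_le_mul_of_nonneg_left hxx (sq_nonneg r)]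

lemma ConeLip.toPL {l : ℝ} {v : ℝ → ℝ → ℝ} (h : ConeLip l 1 v) : PL l v := by
  obtain ⟨K, hK⟩ := h.lipschitz
  refine ⟨|K|, h.periodic, abs_nonneg _, ?_, ?_⟩
  · intro r hr s hs θ
    refine (hK (r, θ) (s, θ) hr hs).trans ?_
    rw [coneDist_rad]
    gcongr; exact le_abs_self K
  · intro r hr θ φ
    refine (hK (r, θ) (r, φ) hr hr).trans ?_
    have := coneDist_ang l r θ φ hr.1
    have h2 : 0 ≤ coneDist l (r, θ) (r, φ) := Real.sqrt_nonneg _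
    calc K * coneDist l (r, θ) (r, φ) ≤ |K| * coneDist l (r, θ) (r, φ) := by
          gcongr; exact le_abs_self K
      _ ≤ _ := by gcongr

lemma PLK.per_int {l K : ℝ} {v : ℝ → ℝ → ℝ} (h : PLK l K v) (r θ : ℝ) (k : ℤ) :
    v r (θ + k * l) = v r θ := by
  have : Function.Periodic (v r) l := fun θ => h.per r θ
  exact this.int_mul k θ

lemma PLK.vertex {l K : ℝ} {v : ℝ → ℝ → ℝ} (h : PLK l K v) (θ φ : ℝ) : v 0 θ = v 0 φ := by
  have := h.ang 0 (by simp) θ φ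
  simp only [zero_mul, mul_zero] at this
  linarith [abs_nonpos_iff.1 this]

lemma PLK.toConeLip {l K : ℝ} {v : ℝ → ℝ → ℝ} (h : PLK l K v) : ConeLip l 1 v := by
  refine ⟨h.per, K * 3, ?_⟩
  rintro ⟨r, θ⟩ ⟨s, φ⟩ hr hs
  simp only at hr hs ⊢
  have hK := h.nonneg
  unfold coneDist
  simp only
  set D := ⨅ k : ℤ, |θ - φ + (k:ℝ) * l| with hD
  have hD0 : 0 ≤ D := le_ciInf fun k => abs_nonneg _
  by_cases hpi : D ≤ Real.pi
  · rw [min_eq_left hpi]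
    have hm : ∀ m ∈ Icc (0:ℝ) 1, |v m θ - v m φ| ≤ K * (m * D) := by
      intro m hm
      rw [hD, Real.mul_iInf_of_nonneg hm.1, Real.mul_iInf_of_nonneg hK]
      refine le_ciInf fun k => ?_
      have := h.ang m hm (θ + k * l) φ
      rw [h.per_int] at this
      rwa [show θ + k * l - φ = θ - φ + k * l by ring] at this
    have hc := Real.cos_le_one_sub_mul_cos_sq (x := D) (by rwa [abs_of_nonneg hD0])
    set d := √(r ^ 2 + s ^ 2 - 2 * r * s * Real.cos D) with hd
    have hd0 : 0 ≤ d := Real.sqrt_nonneg _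
    have hrs : 0 ≤ r * s := mul_nonneg hr.1 hs.1
    have h1 : |r - s| ≤ d := by
      rw [hd]
      apply Real.le_sqrt_of_sq_le
      rw [sq_abs]
      nlinarith [Real.cos_le_one D, mul_le_mul_of_nonneg_left (Real.cos_le_one D) hrs]
    have h2 : ∀ m, 0 ≤ m → m ≤ r → m ≤ s → m * D ≤ 2 * d := by
      intro m hm hmr hms
      have hpi4 := Real.pi_le_four
      have hp := Real.pi_pos
      have h3 : 2 / 4 ^ 2 ≤ 2 / Real.pi ^ 2 := by gcongr
      have h4 : (m * D / 2) ^ 2 ≤ r ^ 2 + s ^ 2 - 2 * r * s * Real.cos D := by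
        have e1 : Real.cos D ≤ 1 - 2 / 4 ^ 2 * D ^ 2 := by nlinarith [sq_nonneg D]
        have e2 := mul_le_mul_of_nonneg_left e1 hrs
        have e3 : m * m ≤ r * s := mul_le_mul hmr hms hm hr.1
        nlinarith [sq_nonneg (r - s), mul_le_mul_of_nonneg_right e3 (sq_nonneg D)]
      have := Real.le_sqrt_of_sq_le h4
      rw [← hd] at this
      linarith
    rcases le_total r s with hle | hle
    · have a1 := hm r hr
      have a2 := h.rad r hr s hs φ
      have a3 := h2 r hr.1 le_rfl hle
      have := abs_sub_le (v r θ) (v r φ) (v s φ)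
      nlinarith [mul_le_mul_of_nonneg_left a3 hK, mul_le_mul_of_nonneg_left h1 hK]
    · have a1 := hm s hs
      have a2 := h.rad r hr s hs θ
      have a3 := h2 s hs.1 hle le_rfl
      have := abs_sub_le (v r θ) (v s θ) (v s φ)
      nlinarith [mul_le_mul_of_nonneg_left a3 hK, mul_le_mul_of_nonneg_left h1 hK]
  · rw [min_eq_right (not_le.1 hpi).le, Real.cos_pi]
    have : √(r ^ 2 + s ^ 2 - 2 * r * s * -1) = r + s := by
      rw [show r ^ 2 + s ^ 2 - 2 * r * s * -1 = (r + s) ^ 2 by ring, Real.sqrt_sq (by linarith [hr.1, hs.1])]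
    rw [this]
    have a1 := h.rad r hr 0 (by simp) θ
    have a2 := h.rad 0 (by simp) s hs φ
    rw [h.vertex φ θ] at a2
    have := abs_sub_le (v r θ) (v 0 θ) (v s φ)
    rw [sub_zero, abs_of_nonneg hr.1] at a1
    rw [zero_sub, abs_neg, abs_of_nonneg hs.1] at a2
    nlinarith [hr.1, hs.1, mul_nonneg hK hr.1, mul_nonneg hK hs.1]

lemma PL.toConeLip {l : ℝ} {v : ℝ → ℝ → ℝ} (h : PL l v) : ConeLip l 1 v := h.choose_spec.toConeLip

/-! ### closure properties -/

lemma PLK.bound {l K : ℝ} {v : ℝ → ℝ → ℝ} (h : PLK l K v) :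
    ∀ r ∈ Icc (0:ℝ) 1, ∀ θ, |v r θ| ≤ |v 0 0| + K := by
  intro r hr θ
  have a1 := h.rad r hr 0 (by simp) θ
  rw [h.vertex θ 0, sub_zero, abs_of_nonneg hr.1] at a1
  have := abs_sub_abs_le_abs_sub (v r θ) (v 0 0)
  nlinarith [hr.2, h.nonneg]

lemma PL.const (l c : ℝ) : PL l (fun _ _ => c) :=
  ⟨0, fun _ _ => rfl, le_rfl, by simp, by simp⟩

lemma PL.add {l : ℝ} {v w : ℝ → ℝ → ℝ} (hv : PL l v) (hw : PL l w) :
    PL l (fun r θ => v r θ + w r θ) := by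
  obtain ⟨K, hK⟩ := hv
  obtain ⟨L, hL⟩ := hw
  refine ⟨K + L, fun r θ => by simp only [hK.per, hL.per], add_nonneg hK.nonneg hL.nonneg, ?_, ?_⟩
  · intro r hr s hs θ
    rw [add_sub_add_comm, add_mul]
    exact (abs_add_le _ _).trans (add_le_add (hK.rad r hr s hs θ) (hL.rad r hr s hs θ))
  · intro r hr θ φ
    rw [add_sub_add_comm, add_mul]
    exact (abs_add_le _ _).trans (add_le_add (hK.ang r hr θ φ) (hL.ang r hr θ φ))

lemma PL.mulRad {l : ℝ} {v : ℝ → ℝ → ℝ} (hv : PL l v) (ψ : ℝ → ℝ) (C L : ℝ)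
    (hC : ∀ r ∈ Icc (0:ℝ) 1, |ψ r| ≤ C)
    (hψ : ∀ r ∈ Icc (0:ℝ) 1, ∀ s ∈ Icc (0:ℝ) 1, |ψ r - ψ s| ≤ L * |r - s|) :
    PL l (fun r θ => ψ r * v r θ) := by
  obtain ⟨K, hK⟩ := hv
  have hC0 : 0 ≤ C := (abs_nonneg _).trans (hC 0 (by simp))
  have hL0 : 0 ≤ L := by
    have := (abs_nonneg _).trans (hψ 0 (by simp) 1 (by simp))
    simpa using this
  have hB0 : 0 ≤ |v 0 0| + K := add_nonneg (abs_nonneg _) hK.nonneg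
  refine ⟨L * (|v 0 0| + K) + C * K, fun r θ => by simp only [hK.per],
    by have := hK.nonneg; positivity, ?_, ?_⟩
  · intro r hr s hs θ
    calc |ψ r * v r θ - ψ s * v s θ| = |(ψ r - ψ s) * v r θ + ψ s * (v r θ - v s θ)| := by
          congr 1; ring
      _ ≤ |ψ r - ψ s| * |v r θ| + |ψ s| * |v r θ - v s θ| := by
          rw [← abs_mul, ← abs_mul]; exact abs_add_le _ _
      _ ≤ (L * |r - s|) * (|v 0 0| + K) + C * (K * |r - s|) := by
          gcongr
          · exact hψ r hr s hs
          · exact hK.bound r hr θ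
          · exact hC s hs
          · exact hK.rad r hr s hs θ
      _ = _ := by ring
  · intro r hr θ φ
    rw [← mul_sub, abs_mul]
    calc |ψ r| * |v r θ - v r φ| ≤ C * (K * (r * |θ - φ|)) := by
          gcongr
          · exact hC r hr
          · exact hK.ang r hr θ φ
      _ ≤ _ := by
          have := mul_nonneg hr.1 (abs_nonneg (θ - φ))
          nlinarith [mul_nonneg (mul_nonneg hL0 hB0) this]

lemma PL.smul {l : ℝ} {v : ℝ → ℝ → ℝ} (hv : PL l v) (c : ℝ) : PL l (fun r θ => c * v r θ) :=
  hv.mulRad (fun _ => c) |c| 0 (fun _ _ => le_rfl) (by simp)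

lemma PL.neg {l : ℝ} {v : ℝ → ℝ → ℝ} (hv : PL l v) : PL l (fun r θ => - v r θ) := by
  simpa using hv.smul (-1)

lemma PL.sub {l : ℝ} {v w : ℝ → ℝ → ℝ} (hv : PL l v) (hw : PL l w) :
    PL l (fun r θ => v r θ - w r θ) := by
  simpa [sub_eq_add_neg] using hv.add hw.neg

lemma PL.max {l : ℝ} {v w : ℝ → ℝ → ℝ} (hv : PL l v) (hw : PL l w) :
    PL l (fun r θ => max (v r θ) (w r θ)) := by
  obtain ⟨K, hK⟩ := hv
  obtain ⟨L, hL⟩ := hw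
  have h1 := hK.nonneg
  have h2 := hL.nonneg
  refine ⟨K + L, fun r θ => by simp only [hK.per, hL.per], add_nonneg h1 h2, ?_, ?_⟩
  · intro r hr s hs θ
    refine (abs_max_sub_max_le_max _ _ _ _).trans (max_le ?_ ?_)
    · exact (hK.rad r hr s hs θ).trans (by gcongr; linarith)
    · exact (hL.rad r hr s hs θ).trans (by gcongr; linarith)
  · intro r hr θ φ
    have := hr.1
    refine (abs_max_sub_max_le_max _ _ _ _).trans (max_le ?_ ?_)
    · exact (hK.ang r hr θ φ).trans (by gcongr; linarith)
    · exact (hL.ang r hr θ φ).trans (by gcongr; linarith)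

lemma PL.min {l : ℝ} {v w : ℝ → ℝ → ℝ} (hv : PL l v) (hw : PL l w) :
    PL l (fun r θ => min (v r θ) (w r θ)) := by
  have := (hv.neg.max hw.neg).neg
  simpa only [max_neg_neg, neg_neg] using this

/-- Gluing along the circle of radius `s`. -/
lemma PL.glue {l s : ℝ} {v w : ℝ → ℝ → ℝ} (hs : s ∈ Icc (0:ℝ) 1) (K : ℝ) (hK0 : 0 ≤ K)
    (per : ∀ r θ : ℝ, v r (θ + l) = v r θ)
    (rad : ∀ r ∈ Icc (0:ℝ) s, ∀ t ∈ Icc (0:ℝ) s, ∀ θ, |v r θ - v t θ| ≤ K * |r - t|)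
    (ang : ∀ r ∈ Icc (0:ℝ) s, ∀ θ φ, |v r θ - v r φ| ≤ K * (r * |θ - φ|))
    (hw : PL l w) (heq : ∀ θ, v s θ = w s θ) :
    PL l (fun r θ => if r ≤ s then v r θ else w r θ) := by
  obtain ⟨L, hL⟩ := hw
  have h2 := hL.nonneg
  have key : ∀ r ∈ Icc (0:ℝ) 1, ∀ t ∈ Icc (0:ℝ) 1, ∀ θ, r ≤ t →
      |(if r ≤ s then v r θ else w r θ) - (if t ≤ s then v t θ else w t θ)|
      ≤ (K + L) * |r - t| := by
    intro r hr t ht θ hrt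
    by_cases h1 : t ≤ s
    · rw [if_pos h1, if_pos (hrt.trans h1)]
      exact (rad r ⟨hr.1, hrt.trans h1⟩ t ⟨ht.1, h1⟩ θ).trans (by gcongr; linarith)
    · rw [if_neg h1]
      by_cases h3 : r ≤ s
      · rw [if_pos h3]
        have a1 := rad r ⟨hr.1, h3⟩ s ⟨hs.1, le_rfl⟩ θ
        have a2 := hL.rad s hs t ht θ
        rw [heq] at a1
        have := abs_sub_le (v r θ) (w s θ) (w t θ)
        push Not at h1
        rw [abs_of_nonpos (show r - s ≤ 0 by linarith)] at a1
        rw [abs_of_nonpos (show s - t ≤ 0 by linarith)] at a2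
        rw [abs_of_nonpos (show r - t ≤ 0 by linarith)]
        nlinarith
      · rw [if_neg h3]
        exact (hL.rad r hr t ht θ).trans (by gcongr; linarith)
  refine ⟨K + L, fun r θ => by simp only [per, hL.per], add_nonneg hK0 h2, ?_, ?_⟩
  · intro r hr t ht θ
    rcases le_total r t with h | h
    · exact key r hr t ht θ h
    · rw [abs_sub_comm, abs_sub_comm r t]
      exact key t ht r hr θ h
  · intro r hr θ φ
    have := hr.1
    by_cases h3 : r ≤ s
    · simp only [if_pos h3]
      exact (ang r ⟨hr.1, h3⟩ θ φ).trans (by gcongr; linarith)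
    · simp only [if_neg h3]
      exact (hL.ang r hr θ φ).trans (by gcongr; linarith)


/-! ### derivatives: measurability, bounds, almost everywhere differentiability -/

def dr (v : ℝ → ℝ → ℝ) (p : ℝ × ℝ) : ℝ := deriv (fun s => v s p.2) p.1
def da (v : ℝ → ℝ → ℝ) (p : ℝ × ℝ) : ℝ := deriv (fun φ => v p.1 φ) p.2

/-- The sector in polar coordinates. -/
def Sec (l a b : ℝ) : Set (ℝ × ℝ) := Ioo a b ×ˢ Ioo (0:ℝ) l

lemma Sec_meas (l a b : ℝ) : MeasurableSet (Sec l a b) := measurableSet_Ioo.prod measurableSet_Ioo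

lemma Sec_vol (l a b : ℝ) : volume (Sec l a b) < ⊤ := by
  rw [Sec, Measure.volume_eq_prod, Measure.prod_prod]
  simp [ENNReal.mul_lt_top_iff]

lemma Sec_mono {l a b c d : ℝ} (h1 : c ≤ a) (h2 : b ≤ d) : Sec l a b ⊆ Sec l c d :=
  prod_mono (Ioo_subset_Ioo h1 h2) Subset.rfl

def clamp (t : ℝ) : ℝ := max 0 (min t 1)

lemma clamp_mem (t : ℝ) : clamp t ∈ Icc (0:ℝ) 1 :=
  ⟨le_max_left _ _, max_le zero_le_one (min_le_right _ _)⟩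

lemma clamp_of_mem {t : ℝ} (h : t ∈ Icc (0:ℝ) 1) : clamp t = t := by
  unfold clamp; rw [min_eq_left h.2, max_eq_right h.1]

lemma clamp_lip (t s : ℝ) : |clamp t - clamp s| ≤ |t - s| := by
  unfold clamp
  refine (abs_max_sub_max_le_max _ _ _ _).trans (max_le (by simp) ?_)
  refine (abs_min_sub_min_le_max _ _ _ _).trans (max_le le_rfl (by simp))

lemma PLK.lip_rad {l K : ℝ} {v : ℝ → ℝ → ℝ} (h : PLK l K v) (θ : ℝ) :
    LipschitzWith K.toNNReal (fun t => v (clamp t) θ) := by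
  apply LipschitzWith.of_dist_le_mul
  intro x y
  rw [Real.coe_toNNReal _ h.nonneg, Real.dist_eq, Real.dist_eq]
  refine (h.rad _ (clamp_mem x) _ (clamp_mem y) θ).trans ?_
  have := h.nonneg
  exact mul_le_mul_of_nonneg_left (clamp_lip x y) this

lemma PLK.lip_ang {l K : ℝ} {v : ℝ → ℝ → ℝ} (h : PLK l K v) (t : ℝ) :
    LipschitzWith K.toNNReal (fun θ => v (clamp t) θ) := by
  apply LipschitzWith.of_dist_le_mul
  intro x y
  rw [Real.coe_toNNReal _ h.nonneg, Real.dist_eq, Real.dist_eq]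
  refine (h.ang _ (clamp_mem t) x y).trans ?_
  have := h.nonneg
  gcongr
  have h2 := clamp_mem t
  nlinarith [h2.1, h2.2, abs_nonneg (x - y)]

lemma PLK.cont {l K : ℝ} {v : ℝ → ℝ → ℝ} (h : PLK l K v) :
    Continuous (Function.uncurry fun t θ => v (clamp t) θ) :=
  (LipschitzWith.uncurry h.lip_rad h.lip_ang).continuous

lemma PLK.cont' {l K : ℝ} {v : ℝ → ℝ → ℝ} (h : PLK l K v) :
    Continuous (Function.uncurry fun θ t => v (clamp t) θ) :=
  h.cont.comp continuous_swap

lemma clamp_ev {t : ℝ} (ht : t ∈ Ioo (0:ℝ) 1) (v : ℝ → ℝ → ℝ) (θ : ℝ) :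
    (fun s => v s θ) =ᶠ[nhds t] (fun s => v (clamp s) θ) := by
  filter_upwards [isOpen_Ioo.mem_nhds ht] with s hs
  rw [clamp_of_mem (Ioo_subset_Icc_self hs)]

lemma dr_clamp {p : ℝ × ℝ} (hp : p.1 ∈ Ioo (0:ℝ) 1) (v : ℝ → ℝ → ℝ) :
    dr v p = deriv (fun s => v (clamp s) p.2) p.1 :=
  (clamp_ev hp v p.2).deriv_eq

lemma da_clamp {p : ℝ × ℝ} (hp : p.1 ∈ Ioo (0:ℝ) 1) (v : ℝ → ℝ → ℝ) :
    da v p = deriv (fun φ => v (clamp p.1) φ) p.2 := by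
  unfold da; rw [clamp_of_mem (Ioo_subset_Icc_self hp)]

lemma PLK.dr_meas {l K : ℝ} {v : ℝ → ℝ → ℝ} (h : PLK l K v) :
    AEStronglyMeasurable (dr v) (volume.restrict (Sec l 0 1)) := by
  have h1 : Measurable fun p : ℝ × ℝ => deriv (fun s => v (clamp s) p.2) p.1 :=
    (measurable_deriv_with_param h.cont').comp measurable_swap
  refine h1.aestronglyMeasurable.congr ?_
  filter_upwards [ae_restrict_mem (Sec_meas l 0 1)] with p hp
  exact (dr_clamp hp.1 v).symm

lemma PLK.da_meas {l K : ℝ} {v : ℝ → ℝ → ℝ} (h : PLK l K v) :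
    AEStronglyMeasurable (da v) (volume.restrict (Sec l 0 1)) := by
  have h1 : Measurable fun p : ℝ × ℝ => deriv (fun φ => v (clamp p.1) φ) p.2 :=
    measurable_deriv_with_param h.cont
  refine h1.aestronglyMeasurable.congr ?_
  filter_upwards [ae_restrict_mem (Sec_meas l 0 1)] with p hp
  exact (da_clamp hp.1 v).symm

lemma PLK.val_meas {l K : ℝ} {v : ℝ → ℝ → ℝ} (h : PLK l K v) :
    AEMeasurable (fun p : ℝ × ℝ => v p.1 p.2) (volume.restrict (Sec l 0 1)) := by
  have h1 : Measurable fun p : ℝ × ℝ => v (clamp p.1) p.2 := h.cont.measurable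
  refine h1.aemeasurable.congr ?_
  filter_upwards [ae_restrict_mem (Sec_meas l 0 1)] with p hp
  rw [clamp_of_mem (Ioo_subset_Icc_self hp.1)]

lemma PLK.dr_le {l K : ℝ} {v : ℝ → ℝ → ℝ} (h : PLK l K v) {p : ℝ × ℝ} (hp : p.1 ∈ Ioo (0:ℝ) 1) :
    |dr v p| ≤ K := by
  unfold dr
  rw [← Real.norm_eq_abs]
  apply norm_deriv_le_of_lip' h.nonneg
  filter_upwards [isOpen_Ioo.mem_nhds hp] with s hs
  exact h.rad s (Ioo_subset_Icc_self hs) p.1 (Ioo_subset_Icc_self hp) p.2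

lemma PLK.da_le {l K : ℝ} {v : ℝ → ℝ → ℝ} (h : PLK l K v) {p : ℝ × ℝ} (hp : p.1 ∈ Ioo (0:ℝ) 1) :
    |da v p| ≤ K * p.1 := by
  unfold da
  rw [← Real.norm_eq_abs]
  apply norm_deriv_le_of_lip' (mul_nonneg h.nonneg hp.1.le)
  filter_upwards with s
  rw [mul_assoc]
  exact h.ang p.1 (Ioo_subset_Icc_self hp) s p.2

lemma vol_Sec (l a b : ℝ) : (volume : Measure (ℝ × ℝ)).restrict (Sec l a b) =
    ((volume : Measure ℝ).restrict (Ioo a b)).prod ((volume : Measure ℝ).restrict (Ioo 0 l)) := by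
  rw [Sec, Measure.volume_eq_prod, Measure.prod_restrict]

def DiffAt (v : ℝ → ℝ → ℝ) (p : ℝ × ℝ) : Prop :=
  DifferentiableAt ℝ (fun s => v s p.2) p.1 ∧ DifferentiableAt ℝ (fun φ => v p.1 φ) p.2

lemma PLK.ae_diff {l K : ℝ} {v : ℝ → ℝ → ℝ} (h : PLK l K v) :
    ∀ᵐ p ∂(volume.restrict (Sec l 0 1)), DiffAt v p := by
  have m1 : MeasurableSet {p : ℝ × ℝ | DifferentiableAt ℝ (fun s => v (clamp s) p.2) p.1} :=
    (measurableSet_of_differentiableAt_with_param ℝ h.cont').preimage measurable_swap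
  have m2 : MeasurableSet {p : ℝ × ℝ | DifferentiableAt ℝ (fun φ => v (clamp p.1) φ) p.2} :=
    measurableSet_of_differentiableAt_with_param ℝ h.cont
  have a1 : ∀ᵐ p ∂(volume.restrict (Sec l 0 1)),
      DifferentiableAt ℝ (fun s => v (clamp s) p.2) p.1 := by
    rw [vol_Sec, Measure.ae_prod_iff_ae_ae m1, Measure.ae_ae_comm (by exact m1)]
    refine Filter.Eventually.of_forall fun θ => ?_
    exact ae_restrict_of_ae (h.lip_rad θ).ae_differentiableAt
  have a2 : ∀ᵐ p ∂(volume.restrict (Sec l 0 1)),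
      DifferentiableAt ℝ (fun φ => v (clamp p.1) φ) p.2 := by
    rw [vol_Sec, Measure.ae_prod_iff_ae_ae m2]
    refine Filter.Eventually.of_forall fun t => ?_
    exact ae_restrict_of_ae (h.lip_ang t).ae_differentiableAt
  filter_upwards [a1, a2, ae_restrict_mem (Sec_meas l 0 1)] with p h1 h2 hp
  refine ⟨h1.congr_of_eventuallyEq (clamp_ev hp.1 v p.2), ?_⟩
  rwa [clamp_of_mem (Ioo_subset_Icc_self hp.1)] at h2

/-! ### integrability -/

/-- bilinear form density -/
def bil (v w : ℝ → ℝ → ℝ) (p : ℝ × ℝ) : ℝ := (dr v p * dr w p + da v p * da w p / p.1 ^ 2) * p.1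

lemma PLK.bil_le {l K L : ℝ} {v w : ℝ → ℝ → ℝ} (h : PLK l K v) (h' : PLK l L w) {p : ℝ × ℝ}
    (hp : p.1 ∈ Ioo (0:ℝ) 1) : |bil v w p| ≤ 2 * K * L := by
  have hp0 := hp.1
  have b1 : |dr v p * dr w p| ≤ K * L := by
    rw [abs_mul]
    exact mul_le_mul (h.dr_le hp) (h'.dr_le hp) (abs_nonneg _) h.nonneg
  have b2 : |da v p * da w p / p.1 ^ 2| ≤ K * L := by
    rw [abs_div, abs_of_pos (pow_pos hp0 2), div_le_iff₀ (by positivity), abs_mul]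
    calc |da v p| * |da w p| ≤ (K * p.1) * (L * p.1) :=
          mul_le_mul (h.da_le hp) (h'.da_le hp) (abs_nonneg _) (mul_nonneg h.nonneg hp0.le)
      _ = _ := by ring
  unfold bil
  rw [abs_mul, abs_of_pos hp0]
  have := abs_add_le (dr v p * dr w p) (da v p * da w p / p.1 ^ 2)
  nlinarith [hp.2, abs_nonneg (dr v p * dr w p + da v p * da w p / p.1 ^ 2)]

lemma PL.bil_int {l : ℝ} {v w : ℝ → ℝ → ℝ} (h : PL l v) (h' : PL l w) :
    IntegrableOn (bil v w) (Sec l 0 1) := by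
  obtain ⟨K, h⟩ := h
  obtain ⟨L, h'⟩ := h'
  refine IntegrableOn.of_bound (Sec_vol l 0 1) ?_ (2 * K * L) ?_
  · unfold bil
    have m1 : AEStronglyMeasurable (fun p : ℝ × ℝ => (p.1)) (volume.restrict (Sec l 0 1)) :=
      measurable_fst.aestronglyMeasurable
    have m2 : AEStronglyMeasurable (fun p : ℝ × ℝ => (p.1 ^ 2)⁻¹) (volume.restrict (Sec l 0 1)) :=
      (measurable_fst.pow_const 2).inv.aestronglyMeasurable
    simp only [div_eq_mul_inv]
    exact ((h.dr_meas.mul h'.dr_meas).add ((h.da_meas.mul h'.da_meas).mul m2)).mul m1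
  · filter_upwards [ae_restrict_mem (Sec_meas l 0 1)] with p hp
    exact h.bil_le h' hp.1

/-- The phase density. -/
def lam (lp lm x : ℝ) : ℝ := (if 0 < x then lp else 0) + (if x < 0 then lm else 0)

lemma lam_meas (lp lm : ℝ) : Measurable (lam lp lm) := by
  unfold lam
  exact (Measurable.ite measurableSet_Ioi measurable_const measurable_const).add
    (Measurable.ite measurableSet_Iio measurable_const measurable_const)

lemma lam_le (lp lm x : ℝ) : |lam lp lm x| ≤ |lp| + |lm| := by
  unfold lam
  refine (abs_add_le _ _).trans (add_le_add ?_ ?_)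
  · split_ifs <;> simp
  · split_ifs <;> simp

lemma PL.lam_int {l : ℝ} {v : ℝ → ℝ → ℝ} (h : PL l v) (lp lm : ℝ) :
    IntegrableOn (fun p : ℝ × ℝ => lam lp lm (v p.1 p.2) * p.1) (Sec l 0 1) := by
  obtain ⟨K, h⟩ := h
  refine IntegrableOn.of_bound (Sec_vol l 0 1) ?_ (|lp| + |lm|) ?_
  · exact (((lam_meas lp lm).comp_aemeasurable h.val_meas).mul
      measurable_fst.aemeasurable).aestronglyMeasurable
  · filter_upwards [ae_restrict_mem (Sec_meas l 0 1)] with p hp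
    rw [Real.norm_eq_abs, abs_mul, abs_of_pos hp.1.1]
    have := lam_le lp lm (v p.1 p.2)
    nlinarith [hp.1.1, hp.1.2, abs_nonneg (lam lp lm (v p.1 p.2))]

def dens (lp lm : ℝ) (v : ℝ → ℝ → ℝ) (p : ℝ × ℝ) : ℝ := bil v v p + lam lp lm (v p.1 p.2) * p.1

lemma dens_eq (lp lm : ℝ) (v : ℝ → ℝ → ℝ) (p : ℝ × ℝ) :
    (gradSq v p + (if 0 < v p.1 p.2 then lp else 0)
      + (if v p.1 p.2 < 0 then lm else 0)) * p.1 = dens lp lm v p := by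
  unfold dens bil lam gradSq dr da; ring

lemma PL.dens_int {l : ℝ} {v : ℝ → ℝ → ℝ} (h : PL l v) (lp lm : ℝ) :
    IntegrableOn (dens lp lm v) (Sec l 0 1) := (h.bil_int h).add (h.lam_int lp lm)

lemma Jfun_eq (l lp lm : ℝ) (v : ℝ → ℝ → ℝ) (R : ℝ) :
    Jfun l lp lm v R = ∫ p in Sec l 0 R, dens lp lm v p := by
  unfold Jfun; simp only [dens_eq]; rfl

lemma Sec_split {l : ℝ} {f : ℝ × ℝ → ℝ} (a b c : ℝ) (hab : a ≤ b) (hbc : b ≤ c)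
    (hf : IntegrableOn f (Sec l a c)) :
    ∫ p in Sec l a c, f p = (∫ p in Sec l a b, f p) + ∫ p in Sec l b c, f p := by
  rw [← setIntegral_union _ (Sec_meas l b c) (hf.mono_set (Sec_mono le_rfl hbc))
    (hf.mono_set (Sec_mono hab le_rfl))]
  · apply setIntegral_congr_set
    have h0 : volume (({b} : Set ℝ) ×ˢ Ioo (0:ℝ) l) = 0 := by
      rw [Measure.volume_eq_prod, Measure.prod_prod]; simp
    have h1 : Sec l a c ⊆ (Sec l a b ∪ Sec l b c) ∪ ({b} : Set ℝ) ×ˢ Ioo (0:ℝ) l := by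
      rintro ⟨t, θ⟩ ⟨ht, hθ⟩
      rcases lt_trichotomy t b with h | h | h
      · exact Or.inl (Or.inl ⟨⟨ht.1, h⟩, hθ⟩)
      · exact Or.inr ⟨h, hθ⟩
      · exact Or.inl (Or.inr ⟨⟨h, ht.2⟩, hθ⟩)
    have h2 : Sec l a b ∪ Sec l b c ⊆ Sec l a c :=
      union_subset (Sec_mono le_rfl hbc) (Sec_mono hab le_rfl)
    apply Filter.EventuallyLE.antisymm
    · refine (LE.le.eventuallyLE h1).trans ?_
      exact (union_ae_eq_left_of_ae_eq_empty (ae_eq_empty.2 h0)).le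
    · exact LE.le.eventuallyLE h2
  · rw [Set.disjoint_left]
    rintro ⟨t, θ⟩ h1 h2
    exact absurd h1.1.2 (not_lt.2 h2.1.1.le)


/-! ### locality -/

lemma dr_congr {a b : ℝ} {v w : ℝ → ℝ → ℝ} (h : ∀ t ∈ Ioo a b, ∀ θ, v t θ = w t θ)
    {p : ℝ × ℝ} (hp : p.1 ∈ Ioo a b) : dr v p = dr w p := by
  apply Filter.EventuallyEq.deriv_eq
  filter_upwards [isOpen_Ioo.mem_nhds hp] with s hs
  exact h s hs p.2

lemma da_congr {a b : ℝ} {v w : ℝ → ℝ → ℝ} (h : ∀ t ∈ Ioo a b, ∀ θ, v t θ = w t θ)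
    {p : ℝ × ℝ} (hp : p.1 ∈ Ioo a b) : da v p = da w p := by
  unfold da
  congr 1
  funext φ
  exact h p.1 hp φ

lemma dens_congr {a b lp lm : ℝ} {v w : ℝ → ℝ → ℝ} (h : ∀ t ∈ Ioo a b, ∀ θ, v t θ = w t θ)
    {p : ℝ × ℝ} (hp : p.1 ∈ Ioo a b) : dens lp lm v p = dens lp lm w p := by
  unfold dens bil
  rw [dr_congr h hp, da_congr h hp, h p.1 hp p.2]

lemma int_dens_congr {l a b lp lm : ℝ} {v w : ℝ → ℝ → ℝ}
    (h : ∀ t ∈ Ioo a b, ∀ θ, v t θ = w t θ) :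
    ∫ p in Sec l a b, dens lp lm v p = ∫ p in Sec l a b, dens lp lm w p :=
  setIntegral_congr_fun (Sec_meas l a b) fun _ hp => dens_congr h hp.1

/-! ### one dimensional facts -/

lemma oneD_pos {f g : ℝ → ℝ} {x : ℝ} (hf : DifferentiableAt ℝ f x) (hg : DifferentiableAt ℝ g x)
    (hfp : DifferentiableAt ℝ (fun y => max (f y) 0) x)
    (hgp : DifferentiableAt ℝ (fun y => max (g y) 0) x)
    (hle : ∀ᶠ y in nhds x, g y ≤ f y) :
    deriv (fun y => max (f y) 0 - max (g y) 0) x * deriv (fun y => max (f y) 0 - max (g y) 0) x =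
      deriv f x * deriv (fun y => max (f y) 0 - max (g y) 0) x -
      (deriv f x - deriv g x) * deriv (fun y => max (g y) 0) x := by
  have hpos : ∀ {h : ℝ → ℝ}, DifferentiableAt ℝ h x → 0 < h x →
      deriv (fun y => max (h y) 0) x = deriv h x := by
    intro h hh h0
    apply Filter.EventuallyEq.deriv_eq
    filter_upwards [hh.continuousAt.eventually (lt_mem_nhds h0)] with y hy
    exact max_eq_left hy.le
  have hneg : ∀ {h : ℝ → ℝ}, h x ≤ 0 → deriv (fun y => max (h y) 0) x = 0 := by
    intro h h0
    apply IsLocalMin.deriv_eq_zero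
    refine Filter.Eventually.of_forall fun y => ?_
    simp only [max_eq_right h0]
    exact le_max_right _ _
  have hx := hle.self_of_nhds
  rw [deriv_fun_sub hfp hgp]
  by_cases h1 : 0 < g x
  · rw [hpos hg h1, hpos hf (h1.trans_le hx)]; ring
  · rw [hneg (not_lt.1 h1)]
    by_cases h2 : 0 < f x
    · rw [hpos hf h2]; ring
    · rw [hneg (not_lt.1 h2)]; ring

lemma oneD_lattice {f g : ℝ → ℝ} {x : ℝ} (hf : DifferentiableAt ℝ f x)
    (hg : DifferentiableAt ℝ g x)
    (hM : DifferentiableAt ℝ (fun y => max (f y) (g y)) x)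
    (hm : DifferentiableAt ℝ (fun y => min (f y) (g y)) x) :
    deriv (fun y => max (f y) (g y)) x * deriv (fun y => max (f y) (g y)) x +
    deriv (fun y => min (f y) (g y)) x * deriv (fun y => min (f y) (g y)) x =
    deriv f x * deriv f x + deriv g x * deriv g x := by
  rcases lt_trichotomy (f x) (g x) with h | h | h
  · have h1 : (fun y => max (f y) (g y)) =ᶠ[nhds x] g := by
      filter_upwards [hf.continuousAt.eventually_lt hg.continuousAt h] with y hy
      exact max_eq_right hy.le
    have h2 : (fun y => min (f y) (g y)) =ᶠ[nhds x] f := by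
      filter_upwards [hf.continuousAt.eventually_lt hg.continuousAt h] with y hy
      exact min_eq_left hy.le
    rw [h1.deriv_eq, h2.deriv_eq]; ring
  · have h1 : deriv (fun y => max (f y) (g y) - f y) x = 0 := by
      apply IsLocalMin.deriv_eq_zero
      refine Filter.Eventually.of_forall fun y => ?_
      simp [h]
    have h2 : deriv (fun y => max (f y) (g y) - g y) x = 0 := by
      apply IsLocalMin.deriv_eq_zero
      refine Filter.Eventually.of_forall fun y => ?_
      simp [h]
    have h3 : deriv (fun y => f y - min (f y) (g y)) x = 0 := by
      apply IsLocalMin.deriv_eq_zero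
      refine Filter.Eventually.of_forall fun y => ?_
      simp [h]
    rw [deriv_fun_sub hM hf] at h1
    rw [deriv_fun_sub hM hg] at h2
    rw [deriv_fun_sub hf hm] at h3
    have e1 : deriv (fun y => max (f y) (g y)) x = deriv f x := by linarith
    have e2 : deriv g x = deriv f x := by linarith
    have e3 : deriv (fun y => min (f y) (g y)) x = deriv f x := by linarith
    rw [e1, e2, e3]
  · have h1 : (fun y => max (f y) (g y)) =ᶠ[nhds x] f := by
      filter_upwards [hg.continuousAt.eventually_lt hf.continuousAt h] with y hy
      exact max_eq_left hy.le
    have h2 : (fun y => min (f y) (g y)) =ᶠ[nhds x] g := by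
      filter_upwards [hg.continuousAt.eventually_lt hf.continuousAt h] with y hy
      exact min_eq_right hy.le
    rw [h1.deriv_eq, h2.deriv_eq]

/-! ### minimizers -/

def IsMinP (l lp lm : ℝ) (u : ℝ → ℝ → ℝ) : Prop :=
  PL l u ∧ ∀ w, PL l w → (∀ θ, w 1 θ = u 1 θ) →
    ∫ p in Sec l 0 1, dens lp lm u p ≤ ∫ p in Sec l 0 1, dens lp lm w p

lemma IsMinimizerJ.isMin {l lp lm : ℝ} {u : ℝ → ℝ → ℝ} (h : IsMinimizerJ l lp lm 1 u) :
    IsMinP l lp lm u := by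
  refine ⟨h.1.toPL, fun w hw hb => ?_⟩
  have := h.2 w hw.toConeLip hb
  rwa [Jfun_eq, Jfun_eq] at this

lemma quad_zero {B Q : ℝ} (h : ∀ ε : ℝ, |ε| < 1 → 0 ≤ 2 * ε * B + ε ^ 2 * Q) : B = 0 := by
  by_contra hB
  have hB2 : 0 < B ^ 2 := by positivity
  set δ : ℝ := 1 / (1 + |B| + |Q|) with hδ
  have hpos : 0 < 1 + |B| + |Q| := by positivity
  have hδ0 : 0 < δ := by positivity
  have h1 : δ * (1 + |B| + |Q|) = 1 := by rw [hδ]; field_simp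
  have h2 : |(-B * δ)| < 1 := by
    rw [abs_mul, abs_neg, abs_of_pos hδ0]
    nlinarith [abs_nonneg B, abs_nonneg Q, mul_nonneg hδ0.le (abs_nonneg Q)]
  have h3 := h _ h2
  have h4 : δ * Q ≤ 1 := by
    nlinarith [abs_nonneg B, le_abs_self Q, mul_nonneg hδ0.le (abs_nonneg B),
      mul_le_mul_of_nonneg_left (le_abs_self Q) hδ0.le]
  nlinarith [mul_pos hδ0 hB2, mul_le_mul_of_nonneg_left h4 (mul_pos hδ0 hB2).le]

lemma lam_pert {lp lm x y : ℝ} {ε : ℝ} (hε : |ε| < 1) (h : |y| ≤ |x|) :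
    lam lp lm (x + ε * y) = lam lp lm x := by
  have h1 : |ε * y| ≤ |ε| * |x| := by rw [abs_mul]; gcongr
  rcases lt_trichotomy x 0 with hx | hx | hx
  · have : x + ε * y < 0 := by
      have h2 : |ε * y| < |x| := by nlinarith [abs_pos_of_neg hx]
      rw [abs_of_neg hx] at h2
      linarith [le_abs_self (ε * y)]
    unfold lam
    rw [if_neg this.not_gt, if_pos this, if_neg hx.not_gt, if_pos hx]
  · subst hx
    have : y = 0 := by simpa using h
    simp [this]
  · have : 0 < x + ε * y := by
      have h2 : |ε * y| < |x| := by nlinarith [abs_pos_of_pos hx]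
      rw [abs_of_pos hx] at h2
      linarith [neg_abs_le (ε * y)]
    unfold lam
    rw [if_neg this.not_gt, if_pos this, if_neg hx.not_gt, if_pos hx]

lemma IsMinP.variation {l lp lm : ℝ} {v η : ℝ → ℝ → ℝ} (hv : IsMinP l lp lm v) (hη : PL l η)
    (h1 : ∀ θ, η 1 θ = 0) (hle : ∀ t ∈ Icc (0:ℝ) 1, ∀ θ, |η t θ| ≤ |v t θ|) :
    ∫ p in Sec l 0 1, bil v η p = 0 := by
  apply quad_zero (Q := ∫ p in Sec l 0 1, bil η η p)
  intro ε hε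
  have hw := hv.1.add (hη.smul ε)
  have h2 := hv.2 _ hw (fun θ => by simp [h1])
  have h3 : ∫ p in Sec l 0 1, dens lp lm (fun r θ => v r θ + ε * η r θ) p =
      ∫ p in Sec l 0 1, (dens lp lm v p + (2 * ε * bil v η p + ε ^ 2 * bil η η p)) := by
    apply integral_congr_ae
    obtain ⟨K, hK⟩ := hv.1
    obtain ⟨L, hL⟩ := hη
    filter_upwards [hK.ae_diff, hL.ae_diff, ae_restrict_mem (Sec_meas l 0 1)] with p d1 d2 hp
    have e1 : dr (fun r θ => v r θ + ε * η r θ) p = dr v p + ε * dr η p := by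
      unfold dr
      rw [deriv_fun_add d1.1 (d2.1.const_mul ε), deriv_const_mul _ d2.1]
    have e2 : da (fun r θ => v r θ + ε * η r θ) p = da v p + ε * da η p := by
      unfold da
      rw [deriv_fun_add d1.2 (d2.2.const_mul ε), deriv_const_mul _ d2.2]
    unfold dens
    simp only [lam_pert hε (hle p.1 (Ioo_subset_Icc_self hp.1) p.2)]
    unfold bil
    rw [e1, e2]
    ring
  have i1 := hv.1.dens_int lp lm
  have i2 := (hv.1.bil_int hη).const_mul (2 * ε)
  have i3 := (hη.bil_int hη).const_mul (ε ^ 2)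
  have i4 : Integrable (fun p => 2 * ε * bil v η p + ε ^ 2 * bil η η p)
      (volume.restrict (Sec l 0 1)) := i2.add i3
  rw [h3, integral_add i1 i4, integral_add i2 i3, integral_const_mul,
    integral_const_mul] at h2
  linarith

lemma dens_neg (lp lm : ℝ) (v : ℝ → ℝ → ℝ) (p : ℝ × ℝ) :
    dens lm lp (fun r θ => - v r θ) p = dens lp lm v p := by
  unfold dens bil dr da lam
  simp only [deriv.fun_neg, Left.neg_pos_iff, Left.neg_neg_iff]
  ring

lemma IsMinP.neg {l lp lm : ℝ} {v : ℝ → ℝ → ℝ} (hv : IsMinP l lp lm v) :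
    IsMinP l lm lp (fun r θ => - v r θ) := by
  refine ⟨hv.1.neg, fun w hw hb => ?_⟩
  have := hv.2 _ hw.neg (fun θ => by rw [hb]; ring)
  simp only [dens_neg]
  rw [← integral_congr_ae (Filter.Eventually.of_forall fun p => dens_neg lp lm (fun r θ => - w r θ) p)] at this
  simpa only [neg_neg] using this

/-- If the radial derivative vanishes a.e. then the function is constant. -/
lemma PL.const_of_dr {l s : ℝ} {v : ℝ → ℝ → ℝ} (hl : 0 < l) (hv : PL l v) (hs1 : s ≤ 1)
    (h : ∀ᵐ p ∂(volume.restrict (Sec l 0 s)), dr v p = 0) :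
    ∀ t ∈ Icc (0:ℝ) s, ∀ θ, v t θ = v 0 0 := by
  intro t ht
  have ht1 : t ∈ Icc (0:ℝ) 1 := ⟨ht.1, ht.2.trans hs1⟩
  obtain ⟨K, hK⟩ := hv
  rw [vol_Sec] at h
  have h2 := Measure.ae_ae_of_ae_prod (Measure.measurePreserving_swap.quasiMeasurePreserving.ae h)
  have h3 : ∀ᵐ θ ∂(volume.restrict (Ioo 0 l)), v t θ = v 0 0 := by
    filter_upwards [h2] with θ hθ
    have ac : AbsolutelyContinuousOnInterval (fun t => v (clamp t) θ) 0 t :=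
      (hK.lip_rad θ).lipschitzOnWith.absolutelyContinuousOnInterval
    have h4 := ac.integral_deriv_eq_sub
    rw [clamp_of_mem ht1, clamp_of_mem (by simp), hK.vertex θ 0] at h4
    have h5 : ∫ x in (0:ℝ)..t, deriv (fun t => v (clamp t) θ) x = 0 := by
      rw [intervalIntegral.integral_of_le ht.1, integral_Ioc_eq_integral_Ioo]
      apply integral_eq_zero_of_ae
      have h6 := ae_restrict_of_ae_restrict_of_subset (Ioo_subset_Ioo_right ht.2) hθ
      filter_upwards [h6, ae_restrict_mem measurableSet_Ioo] with x hx hx1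
      refine Eq.trans ?_ hx
      exact (dr_clamp (p := (x, θ)) ⟨hx1.1, hx1.2.trans_le ht1.2⟩ v).symm
    linarith
  have hc : Continuous (v t) := by
    have := (hK.lip_ang t).continuous
    rwa [clamp_of_mem ht1] at this
  have h7 : EqOn (v t) (fun _ => v 0 0) (Ico 0 l) := by
    rw [restrict_Ioo_eq_restrict_Ico] at h3
    exact Measure.eqOn_Ico_of_ae_eq (μ := volume) h3 hc.continuousOn continuousOn_const
  intro θ
  have hp : Function.Periodic (v t) l := fun θ => hK.per t θ
  obtain ⟨y, hy, hy2⟩ := hp.exists_mem_Ico₀ hl θ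
  rw [hy2]; exact h7 hy


/-! ### unique continuation for minimizers -/

lemma ae_ne_fst (l s : ℝ) : ∀ᵐ p ∂((volume : Measure (ℝ × ℝ)).restrict (Sec l 0 1)), p.1 ≠ s := by
  apply ae_restrict_of_ae
  have h : ∀ᵐ t ∂(volume : Measure ℝ), t ≠ s := by
    simp [ae_iff]
  exact (Measure.quasiMeasurePreserving_fst (μ := (volume : Measure ℝ)) (ν := (volume : Measure ℝ))).ae h

lemma IsMinP.pos_part_eq {l lp lm s : ℝ} {v w : ℝ → ℝ → ℝ} (hl : 0 < l)
    (hs : s ∈ Ioo (0:ℝ) 1) (hv : IsMinP l lp lm v) (hw : IsMinP l lp lm w)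
    (heq : ∀ t ∈ Icc s 1, ∀ θ, v t θ = w t θ)
    (hle : ∀ t ∈ Icc (0:ℝ) 1, ∀ θ, w t θ ≤ v t θ) :
    ∀ t ∈ Icc (0:ℝ) 1, ∀ θ, max (v t θ) 0 = max (w t θ) 0 := by
  set ψ : ℝ → ℝ := fun t => min 1 ((1 - t) / (1 - s)) with hψ
  have hs1 : 0 < 1 - s := by linarith [hs.2]
  have hψ0 : ∀ t ∈ Icc (0:ℝ) 1, 0 ≤ ψ t := fun t ht =>
    le_min zero_le_one (div_nonneg (by linarith [ht.2]) hs1.le)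
  have hψ1 : ∀ t, ψ t ≤ 1 := fun t => min_le_left _ _
  have hψs : ∀ t ≤ s, ψ t = 1 := fun t ht =>
    min_eq_left (by rw [one_le_div hs1]; linarith)
  have hvp := hv.1.max (PL.const l 0)
  have hwp := hw.1.max (PL.const l 0)
  have hφ := hvp.sub hwp
  set vp : ℝ → ℝ → ℝ := fun r θ => max (v r θ) 0 with hvpd
  set wp : ℝ → ℝ → ℝ := fun r θ => max (w r θ) 0 with hwpd
  set φ : ℝ → ℝ → ℝ := fun r θ => vp r θ - wp r θ with hφd
  have hζ : PL l (fun r θ => ψ r * wp r θ) := by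
    apply hwp.mulRad ψ 1 (1 / (1 - s))
    · intro r hr
      rw [abs_of_nonneg (hψ0 r hr)]; exact hψ1 r
    · intro r hr t ht
      refine (abs_min_sub_min_le_max _ _ _ _).trans (max_le (by simp; positivity) ?_)
      rw [← sub_div, abs_div, abs_of_pos hs1, show 1 - r - (1 - t) = t - r by ring, abs_sub_comm]
      apply le_of_eq; ring
  set ζ : ℝ → ℝ → ℝ := fun r θ => ψ r * wp r θ with hζd
  have hwv : ∀ t ∈ Icc (0:ℝ) 1, ∀ θ, wp t θ ≤ vp t θ := fun t ht θ =>
    max_le_max (hle t ht θ) le_rfl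
  have hwp0 : ∀ t θ, 0 ≤ wp t θ := fun t θ => le_max_right _ _
  have hvabs : ∀ t θ, vp t θ ≤ |v t θ| := fun t θ => max_le (le_abs_self _) (abs_nonneg _)
  have hwabs : ∀ t θ, wp t θ ≤ |w t θ| := fun t θ => max_le (le_abs_self _) (abs_nonneg _)
  have hζ0 : ∀ t ∈ Icc (0:ℝ) 1, ∀ θ, 0 ≤ ζ t θ ∧ ζ t θ ≤ wp t θ := fun t ht θ =>
    ⟨mul_nonneg (hψ0 t ht) (hwp0 t θ), mul_le_of_le_one_left (hwp0 t θ) (hψ1 t)⟩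
  have hζ1 : ∀ θ, ζ 1 θ = 0 := fun θ => by simp [hζd, hψ]
  have hφs : ∀ t ∈ Icc s 1, ∀ θ, φ t θ = 0 := fun t ht θ => by
    simp only [hφd, hvpd, hwpd]; rw [heq t ht θ]; ring
  have v1 := hv.variation hφ (fun θ => hφs 1 ⟨hs.2.le, le_rfl⟩ θ) (fun t ht θ => by
    rw [abs_of_nonneg (by simp only [hφd]; linarith [hwv t ht θ])]
    simp only [hφd]; linarith [hvabs t θ, hwp0 t θ])
  have v2 := hv.variation hζ hζ1 (fun t ht θ => by
    rw [abs_of_nonneg (hζ0 t ht θ).1]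
    exact ((hζ0 t ht θ).2.trans (hwv t ht θ)).trans (hvabs t θ))
  have v3 := hw.variation hζ hζ1 (fun t ht θ => by
    rw [abs_of_nonneg (hζ0 t ht θ).1]
    exact (hζ0 t ht θ).2.trans (hwabs t θ))
  have key : ∀ᵐ p ∂((volume : Measure (ℝ × ℝ)).restrict (Sec l 0 1)),
      bil φ φ p = bil v φ p - (bil v ζ p - bil w ζ p) := by
    obtain ⟨K1, k1⟩ := hv.1
    obtain ⟨K2, k2⟩ := hw.1
    obtain ⟨K3, k3⟩ := hvp
    obtain ⟨K4, k4⟩ := hwp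
    filter_upwards [ae_ne_fst l s, k1.ae_diff, k2.ae_diff, k3.ae_diff, k4.ae_diff,
      ae_restrict_mem (Sec_meas l 0 1)] with p hps d1 d2 d3 d4 hp
    rcases lt_or_gt_of_ne hps with h | h
    · have hz : ∀ t ∈ Ioo 0 s, ∀ θ, ζ t θ = wp t θ := fun t ht θ => by
        simp only [hζd]; rw [hψs t ht.2.le, one_mul]
      have hp' : p.1 ∈ Ioo 0 s := ⟨hp.1.1, h⟩
      have e1 : dr φ p * dr φ p = dr v p * dr φ p - (dr v p - dr w p) * dr wp p := by
        refine oneD_pos d1.1 d2.1 d3.1 d4.1 ?_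
        filter_upwards [isOpen_Ioo.mem_nhds hp.1] with t ht
        exact hle t (Ioo_subset_Icc_self ht) p.2
      have e2 : da φ p * da φ p = da v p * da φ p - (da v p - da w p) * da wp p := by
        refine oneD_pos d1.2 d2.2 d3.2 d4.2 ?_
        exact Filter.Eventually.of_forall fun θ => hle p.1 (Ioo_subset_Icc_self hp.1) θ
      unfold bil
      rw [dr_congr hz hp', da_congr hz hp', e1, e2]
      ring
    · have hp' : p.1 ∈ Ioo s 1 := ⟨h, hp.1.2⟩
      have z1 : ∀ t ∈ Ioo s 1, ∀ θ, φ t θ = (fun _ _ => (0:ℝ)) t θ :=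
        fun t ht θ => hφs t (Ioo_subset_Icc_self ht) θ
      have z2 : ∀ t ∈ Ioo s 1, ∀ θ, v t θ = w t θ :=
        fun t ht θ => heq t (Ioo_subset_Icc_self ht) θ
      have y1 : dr φ p = 0 := by rw [dr_congr z1 hp']; simp [dr]
      have y2 : da φ p = 0 := by rw [da_congr z1 hp']; simp [da]
      unfold bil
      rw [y1, y2, dr_congr z2 hp', da_congr z2 hp']
      ring
  have h0 : ∫ p in Sec l 0 1, bil φ φ p = 0 := by
    have i1 := hv.1.bil_int hφ
    have i2 := hv.1.bil_int hζ
    have i3 := hw.1.bil_int hζ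
    have i4 : Integrable (fun p => bil v ζ p - bil w ζ p) (volume.restrict (Sec l 0 1)) :=
      i2.sub i3
    rw [integral_congr_ae key, integral_sub i1 i4, integral_sub i2 i3, v1, v2, v3]
    simp
  have hnn : ∀ p ∈ Sec l 0 1, 0 ≤ bil φ φ p := by
    intro p hp
    unfold bil
    have := hp.1.1
    have a1 := mul_self_nonneg (dr φ p)
    have a2 := mul_self_nonneg (da φ p)
    positivity
  rw [setIntegral_eq_zero_iff_of_nonneg_ae
    ((ae_restrict_mem (Sec_meas l 0 1)).mono fun p hp => hnn p hp) (hφ.bil_int hφ)] at h0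
  have hc := hφ.const_of_dr hl le_rfl (by
    filter_upwards [h0, ae_restrict_mem (Sec_meas l 0 1)] with p hp hp1
    have hpos := hp1.1.1
    simp only [bil, Pi.zero_apply] at hp
    have a1 := mul_self_nonneg (dr φ p)
    have a2 : 0 ≤ da φ p * da φ p / p.1 ^ 2 := div_nonneg (mul_self_nonneg _) (by positivity)
    have : dr φ p * dr φ p + da φ p * da φ p / p.1 ^ 2 = 0 := by
      rcases mul_eq_zero.1 hp with h | h
      · exact h
      · exact absurd h hpos.ne'
    exact mul_self_eq_zero.1 (by linarith))
  intro t ht θ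
  have b1 := hc t ht θ
  have b2 := hc 1 (by simp) 0
  rw [hφs 1 ⟨hs.2.le, le_rfl⟩] at b2
  rw [← b2] at b1
  simp only [hφd] at b1
  linarith

lemma IsMinP.eq_of_le {l lp lm s : ℝ} {v w : ℝ → ℝ → ℝ} (hl : 0 < l)
    (hs : s ∈ Ioo (0:ℝ) 1) (hv : IsMinP l lp lm v) (hw : IsMinP l lp lm w)
    (heq : ∀ t ∈ Icc s 1, ∀ θ, v t θ = w t θ)
    (hle : ∀ t ∈ Icc (0:ℝ) 1, ∀ θ, w t θ ≤ v t θ) :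
    ∀ t ∈ Icc (0:ℝ) 1, ∀ θ, v t θ = w t θ := by
  intro t ht θ
  have h1 := IsMinP.pos_part_eq hl hs hv hw heq hle t ht θ
  have h2 := IsMinP.pos_part_eq hl hs hw.neg hv.neg
    (fun t ht θ => by simp only [heq t ht θ]) (fun t ht θ => neg_le_neg (hle t ht θ)) t ht θ
  have e : ∀ x : ℝ, x = max x 0 - max (-x) 0 := fun x => by
    rcases le_total x 0 with h | h
    · rw [max_eq_right h, max_eq_left (by linarith)]; ring
    · rw [max_eq_left h, max_eq_right (by linarith)]; ring
  rw [e (v t θ), e (w t θ), h1, h2]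

lemma lam_lattice (lp lm x y : ℝ) :
    lam lp lm (max x y) + lam lp lm (min x y) = lam lp lm x + lam lp lm y := by
  rcases le_total x y with h | h
  · rw [max_eq_right h, min_eq_left h, add_comm]
  · rw [max_eq_left h, min_eq_right h]

lemma lattice_energy {l : ℝ} {v w : ℝ → ℝ → ℝ} (lp lm : ℝ) (hv : PL l v) (hw : PL l w) :
    (∫ p in Sec l 0 1, dens lp lm (fun r θ => max (v r θ) (w r θ)) p) +
    (∫ p in Sec l 0 1, dens lp lm (fun r θ => min (v r θ) (w r θ)) p) =
    (∫ p in Sec l 0 1, dens lp lm v p) + ∫ p in Sec l 0 1, dens lp lm w p := by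
  have hM := hv.max hw
  have hm := hv.min hw
  rw [← integral_add (hM.dens_int lp lm) (hm.dens_int lp lm),
    ← integral_add (hv.dens_int lp lm) (hw.dens_int lp lm)]
  apply integral_congr_ae
  obtain ⟨K1, k1⟩ := hv
  obtain ⟨K2, k2⟩ := hw
  obtain ⟨K3, k3⟩ := hM
  obtain ⟨K4, k4⟩ := hm
  filter_upwards [k1.ae_diff, k2.ae_diff, k3.ae_diff, k4.ae_diff] with p d1 d2 d3 d4
  have e1 : dr (fun r θ => max (v r θ) (w r θ)) p * dr (fun r θ => max (v r θ) (w r θ)) p +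
      dr (fun r θ => min (v r θ) (w r θ)) p * dr (fun r θ => min (v r θ) (w r θ)) p =
      dr v p * dr v p + dr w p * dr w p := oneD_lattice d1.1 d2.1 d3.1 d4.1
  have e2 : da (fun r θ => max (v r θ) (w r θ)) p * da (fun r θ => max (v r θ) (w r θ)) p +
      da (fun r θ => min (v r θ) (w r θ)) p * da (fun r θ => min (v r θ) (w r θ)) p =
      da v p * da v p + da w p * da w p := oneD_lattice d1.2 d2.2 d3.2 d4.2
  have e3 := lam_lattice lp lm (v p.1 p.2) (w p.1 p.2)
  unfold dens
  unfold bil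
  simp only [div_eq_mul_inv]
  linear_combination p.1 * e1 + (p.1 ^ 2)⁻¹ * p.1 * e2 + p.1 * e3

/-- Two minimizers that agree near the boundary agree everywhere. -/
lemma IsMinP.unique {l lp lm s : ℝ} {v w : ℝ → ℝ → ℝ} (hl : 0 < l)
    (hs : s ∈ Ioo (0:ℝ) 1) (hv : IsMinP l lp lm v) (hw : PL l w)
    (hJ : ∫ p in Sec l 0 1, dens lp lm w p ≤ ∫ p in Sec l 0 1, dens lp lm v p)
    (heq : ∀ t ∈ Icc s 1, ∀ θ, v t θ = w t θ) :
    ∀ t ∈ Icc (0:ℝ) 1, ∀ θ, v t θ = w t θ := by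
  have h1 : ∀ θ, v 1 θ = w 1 θ := heq 1 ⟨hs.2.le, le_rfl⟩
  have hwm : IsMinP l lp lm w :=
    ⟨hw, fun z hz hb => hJ.trans (hv.2 z hz fun θ => (hb θ).trans (h1 θ).symm)⟩
  have hM := hv.1.max hw
  have hm := hv.1.min hw
  have hMm : IsMinP l lp lm (fun r θ => max (v r θ) (w r θ)) := by
    refine ⟨hM, fun z hz hb => ?_⟩
    have a1 := lattice_energy lp lm hv.1 hw
    have a2 := hv.2 _ hm (fun θ => by simp [h1])
    have a3 := hv.2 z hz (fun θ => by rw [hb θ]; simp [h1])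
    linarith
  intro t ht θ
  have c1 := IsMinP.eq_of_le hl hs hMm hv (fun t ht θ => by simp [heq t ht θ])
    (fun t _ θ => le_max_left _ _) t ht θ
  have c2 := IsMinP.eq_of_le hl hs hMm hwm (fun t ht θ => by simp [heq t ht θ])
    (fun t _ θ => le_max_right _ _) t ht θ
  exact c1.symm.trans c2


/-! ### competitors -/

lemma Sec_fubini {l a b : ℝ} {f : ℝ × ℝ → ℝ} (hf : IntegrableOn f (Sec l a b)) :
    ∫ p in Sec l a b, f p = ∫ t in Ioo a b, ∫ θ in Ioo 0 l, f (t, θ) :=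
  setIntegral_prod f hf

/-- Local minimality. -/
lemma IsMinP.local_min {l lp lm s : ℝ} {u v : ℝ → ℝ → ℝ} (hu : IsMinP l lp lm u)
    (hs : s ∈ Ioo (0:ℝ) 1) (hz : PL l (fun r θ => if r ≤ s then v r θ else u r θ)) :
    ∫ p in Sec l 0 s, dens lp lm u p ≤ ∫ p in Sec l 0 s, dens lp lm v p := by
  have h1 := hu.2 _ hz (fun θ => by simp [not_le.2 hs.2])
  rw [Sec_split 0 s 1 hs.1.le hs.2.le (hu.1.dens_int lp lm),
    Sec_split 0 s 1 hs.1.le hs.2.le (hz.dens_int lp lm)] at h1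
  have h2 : ∫ p in Sec l s 1, dens lp lm (fun r θ => if r ≤ s then v r θ else u r θ) p =
      ∫ p in Sec l s 1, dens lp lm u p :=
    int_dens_congr fun t ht θ => by simp [not_le.2 ht.1]
  have h3 : ∫ p in Sec l 0 s, dens lp lm (fun r θ => if r ≤ s then v r θ else u r θ) p =
      ∫ p in Sec l 0 s, dens lp lm v p :=
    int_dens_congr fun t ht θ => by simp [ht.2.le]
  rw [h2, h3] at h1
  linarith

/-- The homogeneous extension. -/
def homo (u : ℝ → ℝ → ℝ) (s : ℝ) : ℝ → ℝ → ℝ := fun t θ => t * (u s θ / s)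

/-- The energy density of the trace. -/
def eden (lp lm : ℝ) (u : ℝ → ℝ → ℝ) (s θ : ℝ) : ℝ :=
  (u s θ / s) ^ 2 + (deriv (u s) θ / s) ^ 2 + lam lp lm (u s θ)

lemma lam_mul {lp lm c x : ℝ} (hc : 0 < c) : lam lp lm (c * x) = lam lp lm x := by
  have h2 : c * x < 0 ↔ x < 0 := by
    constructor <;> intro h <;> by_contra h' <;> push Not at h' <;> nlinarith
  unfold lam
  simp only [mul_pos_iff_of_pos_left hc, h2]

lemma dr_homo (u : ℝ → ℝ → ℝ) (s : ℝ) (p : ℝ × ℝ) : dr (homo u s) p = u s p.2 / s := by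
  unfold dr homo
  simp

lemma dens_homo {lp lm s : ℝ} (u : ℝ → ℝ → ℝ) (hs : 0 < s) {p : ℝ × ℝ} (hp : 0 < p.1) :
    dens lp lm (homo u s) p = p.1 * eden lp lm u s p.2 := by
  have h1 : da (homo u s) p = p.1 * (deriv (u s) p.2 / s) := by
    unfold da homo
    rw [deriv_const_mul_field, deriv_div_const]
  have h2 : lam lp lm (homo u s p.1 p.2) = lam lp lm (u s p.2) := by
    unfold homo
    rw [← mul_div_assoc, mul_div_right_comm, lam_mul (by positivity)]
  unfold dens bil eden
  rw [dr_homo, h1, h2]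
  field_simp

lemma int_homo {l lp lm s R : ℝ} (u : ℝ → ℝ → ℝ) (hs : 0 < s) (hR : 0 ≤ R) :
    ∫ p in Sec l 0 R, dens lp lm (homo u s) p = R ^ 2 / 2 * ∫ θ in Ioo 0 l, eden lp lm u s θ := by
  rw [setIntegral_congr_fun (Sec_meas l 0 R) (g := fun p => p.1 * eden lp lm u s p.2)
    (fun p hp => dens_homo u hs hp.1.1)]
  unfold Sec
  rw [Measure.volume_eq_prod, setIntegral_prod_mul (fun t : ℝ => t) (eden lp lm u s)]
  congr 1
  rw [← integral_Ioc_eq_integral_Ioo, ← intervalIntegral.integral_of_le hR, integral_id]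
  simp

lemma PLK.homo_rad {l K s : ℝ} {u : ℝ → ℝ → ℝ} (hu : PLK l K u) (hu0 : u 0 0 = 0)
    (hs : s ∈ Ioo (0:ℝ) 1) (r t θ : ℝ) :
    |homo u s r θ - homo u s t θ| ≤ K * |r - t| := by
  have h1 := hu.rad s (Ioo_subset_Icc_self hs) 0 (by simp) θ
  rw [hu.vertex θ 0, hu0, sub_zero, sub_zero, abs_of_pos hs.1] at h1
  unfold homo
  rw [← sub_mul, abs_mul, abs_div, abs_of_pos hs.1, mul_comm K]
  gcongr
  rw [div_le_iff₀ hs.1]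
  exact h1

lemma PLK.homo_ang {l K s : ℝ} {u : ℝ → ℝ → ℝ} (hu : PLK l K u)
    (hs : s ∈ Ioo (0:ℝ) 1) (r θ φ : ℝ) (hr : 0 ≤ r) :
    |homo u s r θ - homo u s r φ| ≤ K * (r * |θ - φ|) := by
  have h1 := hu.ang s (Ioo_subset_Icc_self hs) θ φ
  unfold homo
  rw [← mul_sub, ← sub_div, abs_mul, abs_div, abs_of_pos hs.1, abs_of_nonneg hr]
  rw [show K * (r * |θ - φ|) = r * (K * |θ - φ|) by ring]
  gcongr
  rw [div_le_iff₀ hs.1]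
  linarith

lemma PLK.homo_PL {l K s : ℝ} {u : ℝ → ℝ → ℝ} (hu : PLK l K u) (hu0 : u 0 0 = 0)
    (hs : s ∈ Ioo (0:ℝ) 1) : PL l (homo u s) :=
  ⟨K, fun r θ => by simp only [homo, hu.per], hu.nonneg,
    fun r _ t _ θ => hu.homo_rad hu0 hs r t θ, fun r hr θ φ => hu.homo_ang hs r θ φ hr.1⟩

lemma homo_self {s : ℝ} (u : ℝ → ℝ → ℝ) (hs : s ∈ Ioo (0:ℝ) 1) (θ : ℝ) : homo u s s θ = u s θ := by
  have := hs.1.ne'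
  unfold homo; field_simp

lemma homo_glue {l s : ℝ} {u : ℝ → ℝ → ℝ} (hu : PL l u) (hu0 : u 0 0 = 0)
    (hs : s ∈ Ioo (0:ℝ) 1) : PL l (fun r θ => if r ≤ s then homo u s r θ else u r θ) := by
  obtain ⟨K, hK⟩ := hu
  exact PL.glue (Ioo_subset_Icc_self hs) K hK.nonneg (fun r θ => by simp only [homo, hK.per])
    (fun r _ t _ θ => hK.homo_rad hu0 hs r t θ) (fun r hr θ φ => hK.homo_ang hs r θ φ hr.1)
    ⟨K, hK⟩ (homo_self u hs)

lemma IsMinP.le_homo {l lp lm s : ℝ} {u : ℝ → ℝ → ℝ} (hu : IsMinP l lp lm u) (hu0 : u 0 0 = 0)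
    (hs : s ∈ Ioo (0:ℝ) 1) :
    ∫ p in Sec l 0 s, dens lp lm u p ≤ s ^ 2 / 2 * ∫ θ in Ioo 0 l, eden lp lm u s θ := by
  rw [← int_homo u hs.1 hs.1.le]
  exact hu.local_min hs (homo_glue hu.1 hu0 hs)

/-- dilation -/
def dil (u : ℝ → ℝ → ℝ) (ρ : ℝ) : ℝ → ℝ → ℝ := fun t θ => ρ * u (t / ρ) θ

lemma dens_dil {lp lm ρ : ℝ} (u : ℝ → ℝ → ℝ) (hρ : 0 < ρ) {p : ℝ × ℝ} (hp : 0 < p.1) :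
    dens lp lm (dil u ρ) p = ρ * dens lp lm u (p.1 / ρ, p.2) := by
  have h1 : dr (dil u ρ) p = dr u (p.1 / ρ, p.2) := by
    unfold dr dil
    rw [deriv_const_mul_field]
    have := deriv_comp_mul_left (ρ⁻¹) (fun s => u s p.2) p.1
    simp only [div_eq_inv_mul]
    rw [this, smul_eq_mul]
    field_simp
  have h2 : da (dil u ρ) p = ρ * da u (p.1 / ρ, p.2) := by
    unfold da dil
    rw [deriv_const_mul_field]
  have h3 : lam lp lm (dil u ρ p.1 p.2) = lam lp lm (u (p.1 / ρ) p.2) := lam_mul hρ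
  unfold dens bil
  rw [h1, h2, h3]
  field_simp

lemma PL.dil_PL {l ρ : ℝ} {u : ℝ → ℝ → ℝ} (hu : PL l u) (hρ : 1 ≤ ρ) : PL l (dil u ρ) := by
  obtain ⟨K, hK⟩ := hu
  have h0 : 0 < ρ := by linarith
  have hm : ∀ r ∈ Icc (0:ℝ) 1, r / ρ ∈ Icc (0:ℝ) 1 := fun r hr =>
    ⟨div_nonneg hr.1 h0.le, by rw [div_le_one h0]; linarith [hr.2]⟩
  refine ⟨K, fun r θ => by simp only [dil, hK.per], hK.nonneg, ?_, ?_⟩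
  · intro r hr t ht θ
    have := hK.rad _ (hm r hr) _ (hm t ht) θ
    unfold dil
    rw [← mul_sub, abs_mul, abs_of_pos h0]
    rw [← sub_div, abs_div, abs_of_pos h0, ← mul_div_assoc, le_div_iff₀ h0] at this
    linarith
  · intro r hr θ φ
    have := hK.ang _ (hm r hr) θ φ
    unfold dil
    rw [← mul_sub, abs_mul, abs_of_pos h0]
    rw [div_mul_eq_mul_div, ← mul_div_assoc, le_div_iff₀ h0] at this
    linarith

lemma int_dil {l lp lm ρ R : ℝ} {u : ℝ → ℝ → ℝ} (hu : PL l u) (hρ : 1 ≤ ρ) (hR : 0 ≤ R)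
    (hR1 : R * ρ ≤ 1) :
    ∫ p in Sec l 0 (R * ρ), dens lp lm (dil u ρ) p =
      ρ ^ 2 * ∫ p in Sec l 0 R, dens lp lm u p := by
  have h0 : 0 < ρ := by linarith
  have hRR : R ≤ 1 := by nlinarith
  rw [Sec_fubini (((hu.dil_PL hρ).dens_int lp lm).mono_set (Sec_mono le_rfl hR1)),
    Sec_fubini ((hu.dens_int lp lm).mono_set (Sec_mono le_rfl hRR))]
  have h1 : ∫ t in Ioo 0 (R * ρ), ∫ θ in Ioo 0 l, dens lp lm (dil u ρ) (t, θ) =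
      ∫ t in Ioo 0 (R * ρ), ρ * (fun x => ∫ θ in Ioo 0 l, dens lp lm u (x, θ)) (t / ρ) := by
    apply setIntegral_congr_fun measurableSet_Ioo
    intro t ht
    simp only
    rw [← integral_const_mul]
    congr 1
    funext θ
    exact dens_dil u h0 ht.1
  rw [h1, integral_const_mul, ← integral_Ioc_eq_integral_Ioo,
    ← intervalIntegral.integral_of_le (by positivity), 
    intervalIntegral.integral_comp_div (fun x => ∫ θ in Ioo 0 l, dens lp lm u (x, θ)) h0.ne',
    ← integral_Ioc_eq_integral_Ioo, ← intervalIntegral.integral_of_le hR, smul_eq_mul, zero_div,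
    mul_div_cancel_right₀ _ h0.ne']
  ring

/-- A minimizer homogeneous on an annulus is homogeneous inside. -/
lemma IsMinP.homo_inside {l lp lm r₁ r₂ : ℝ} {u : ℝ → ℝ → ℝ} (hl : 0 < l)
    (hu : IsMinP l lp lm u) (hu0 : u 0 0 = 0)
    (h1 : r₁ ∈ Ioo (0:ℝ) 1) (h2 : r₂ ∈ Ioo (0:ℝ) 1) (h12 : r₁ < r₂)
    (hom : ∀ s ∈ Icc r₁ r₂, ∀ θ, u s θ = homo u r₂ s θ) :
    ∀ t ∈ Icc 0 r₂, ∀ θ, u t θ = homo u r₂ t θ := by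
  have hz := homo_glue hu.1 hu0 h2
  have hh : PL l (homo u r₂) := hu.1.choose_spec.homo_PL hu0 h2
  set c := (∫ θ in Ioo 0 l, eden lp lm u r₂ θ) / 2 with hc
  have hE : ∀ R, 0 ≤ R → ∫ p in Sec l 0 R, dens lp lm (homo u r₂) p = R ^ 2 * c := by
    intro R hR
    rw [int_homo u h2.1 hR, hc]; ring
  have hρ : 1 ≤ r₂ / r₁ := by rw [one_le_div h1.1]; exact h12.le
  have hr : r₁ * (r₂ / r₁) = r₂ := by have := h1.1.ne'; field_simp
  -- dilation competitor
  have hd : ∫ p in Sec l 0 r₂, dens lp lm u p ≤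
      (r₂ / r₁) ^ 2 * ∫ p in Sec l 0 r₁, dens lp lm u p := by
    have e := int_dil (lp := lp) (lm := lm) hu.1 hρ h1.1.le (by rw [hr]; exact h2.2.le)
    rw [hr] at e
    rw [← e]
    apply hu.local_min h2
    obtain ⟨K, hK⟩ := hu.1.dil_PL hρ
    refine PL.glue (Ioo_subset_Icc_self h2) K hK.nonneg hK.per
      (fun r hr t ht θ => hK.rad r ⟨hr.1, hr.2.trans h2.2.le⟩ t ⟨ht.1, ht.2.trans h2.2.le⟩ θ)
      (fun r hr θ φ => hK.ang r ⟨hr.1, hr.2.trans h2.2.le⟩ θ φ) hu.1 ?_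
    intro θ
    have e1 : r₂ / (r₂ / r₁) = r₁ := by
      have := h1.1.ne'; have := h2.1.ne'; field_simp
    unfold dil
    rw [e1, hom r₁ ⟨le_rfl, h12.le⟩ θ]
    unfold homo
    have := h1.1.ne'; have := h2.1.ne'; field_simp
  have hs1 := Sec_split 0 r₁ r₂ h1.1.le h12.le
    ((hu.1.dens_int lp lm).mono_set (Sec_mono le_rfl h2.2.le))
  have hs2 := Sec_split 0 r₁ r₂ h1.1.le h12.le
    ((hh.dens_int lp lm).mono_set (Sec_mono le_rfl h2.2.le))
  rw [hE _ h1.1.le, hE _ h2.1.le] at hs2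
  have hs3 : ∫ p in Sec l r₁ r₂, dens lp lm u p = ∫ p in Sec l r₁ r₂, dens lp lm (homo u r₂) p :=
    int_dens_congr fun t ht θ => hom t (Ioo_subset_Icc_self ht) θ
  set J1 := ∫ p in Sec l 0 r₁, dens lp lm u p with hJ1
  have hfin : r₁ ^ 2 * c ≤ J1 := by
    rw [hs1, hs3] at hd
    have h3 : r₁ ^ 2 * (r₂ / r₁) ^ 2 = r₂ ^ 2 := by rw [← mul_pow, hr]
    have h4 : J1 + (r₂ ^ 2 - r₁ ^ 2) * c ≤ (r₂ / r₁) ^ 2 * J1 := by linarith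
    have h5 := mul_le_mul_of_nonneg_left h4 (sq_nonneg r₁)
    rw [← mul_assoc, h3] at h5
    have h6 : 0 < r₂ ^ 2 - r₁ ^ 2 := by nlinarith [h1.1]
    by_contra hcon
    push Not at hcon
    nlinarith [mul_lt_mul_of_pos_left hcon h6]
  have heq : ∀ t ∈ Icc r₁ 1, ∀ θ, u t θ = (if t ≤ r₂ then homo u r₂ t θ else u t θ) := by
    intro t ht θ
    by_cases h : t ≤ r₂
    · rw [if_pos h]; exact hom t ⟨ht.1, h⟩ θ
    · rw [if_neg h]
  have hun := hu.unique hl h1 hz (by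
    rw [Sec_split 0 r₁ 1 h1.1.le h1.2.le (hu.1.dens_int lp lm),
      Sec_split 0 r₁ 1 h1.1.le h1.2.le (hz.dens_int lp lm)]
    have b1 : ∫ p in Sec l r₁ 1, dens lp lm (fun r θ => if r ≤ r₂ then homo u r₂ r θ else u r θ) p
        = ∫ p in Sec l r₁ 1, dens lp lm u p :=
      int_dens_congr fun t ht θ => (heq t (Ioo_subset_Icc_self ht) θ).symm
    have b2 : ∫ p in Sec l 0 r₁, dens lp lm (fun r θ => if r ≤ r₂ then homo u r₂ r θ else u r θ) p
        = ∫ p in Sec l 0 r₁, dens lp lm (homo u r₂) p :=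
      int_dens_congr fun t ht θ => if_pos (ht.2.le.trans h12.le)
    rw [b1, b2, hE _ h1.1.le]
    linarith) heq
  intro t ht θ
  have := hun t ⟨ht.1, ht.2.trans h2.2.le⟩ θ
  rwa [if_pos ht.2] at this

lemma Weiss_eq (l lp lm : ℝ) (u : ℝ → ℝ → ℝ) (r : ℝ) : Weiss l lp lm u r =
    (1 / r ^ 2) * (∫ p in Sec l 0 r, dens lp lm u p) - (1 / r) * ∫ p in Sec l 0 r, (dr u p) ^ 2 := by
  unfold Weiss
  rw [Jfun_eq]
  rfl

lemma Weiss_homo {l lp lm r s : ℝ} {u : ℝ → ℝ → ℝ} (hr : 0 < r) (hrs : r ≤ s)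
    (hom : ∀ t ∈ Icc 0 s, ∀ θ, u t θ = homo u s t θ) :
    Weiss l lp lm u r = (∫ θ in Ioo 0 l, eden lp lm u s θ) / 2 -
      ∫ θ in Ioo 0 l, (u s θ / s) ^ 2 := by
  have hs : 0 < s := hr.trans_le hrs
  have hom' : ∀ t ∈ Ioo 0 r, ∀ θ, u t θ = homo u s t θ :=
    fun t ht θ => hom t ⟨ht.1.le, ht.2.le.trans hrs⟩ θ
  rw [Weiss_eq, int_dens_congr hom', int_homo u hs hr.le]
  have : ∫ p in Sec l 0 r, (dr u p) ^ 2 = r * ∫ θ in Ioo 0 l, (u s θ / s) ^ 2 := by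
    rw [setIntegral_congr_fun (Sec_meas l 0 r)
      (g := fun p => (fun _ : ℝ => (1:ℝ)) p.1 * (fun θ => (u s θ / s) ^ 2) p.2)
      (fun p hp => by simp only [dr_congr hom' hp.1, dr_homo, one_mul])]
    unfold Sec
    rw [Measure.volume_eq_prod, setIntegral_prod_mul (fun _ : ℝ => (1:ℝ)) (fun θ => (u s θ / s) ^ 2)]
    congr 1
    simp [hr.le]
  rw [this]
  field_simp


/-! ### the derivative of the Weiss energy -/

lemma weiss_ac {j a : ℝ → ℝ} (hj : IntervalIntegrable j volume 0 1)
    (ha : IntervalIntegrable a volume 0 1) {r₁ r₂ : ℝ} (h1 : 0 < r₁) (h12 : r₁ ≤ r₂)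
    (h2 : r₂ < 1) :
    AbsolutelyContinuousOnInterval
      (fun r => (1 / r ^ 2) * (∫ t in (0:ℝ)..r, j t) - (1 / r) * ∫ t in (0:ℝ)..r, a t) r₁ r₂ := by
  have hsub : uIcc r₁ r₂ ⊆ uIcc (0:ℝ) 1 := by
    rw [uIcc_of_le h12, uIcc_of_le zero_le_one]
    exact Icc_subset_Icc h1.le h2.le
  have A1 := (hj.absolutelyContinuousOnInterval_intervalIntegral (c := 0) (by simp)).mono hsub
  have A2 := (ha.absolutelyContinuousOnInterval_intervalIntegral (c := 0) (by simp)).mono hsub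
  have hne : ∀ x ∈ uIcc r₁ r₂, x ≠ 0 := by
    intro x hx
    rw [uIcc_of_le h12] at hx
    exact (h1.trans_le hx.1).ne'
  have B1 : AbsolutelyContinuousOnInterval (fun r : ℝ => 1 / r ^ 2) r₁ r₂ :=
    (contDiffOn_const.div (contDiffOn_id.pow 2)
      (fun x hx => pow_ne_zero 2 (hne x hx))).absolutelyContinuousOnInterval
  have B2 : AbsolutelyContinuousOnInterval (fun r : ℝ => 1 / r) r₁ r₂ :=
    (contDiffOn_const.div contDiffOn_id (fun x hx => hne x hx)).absolutelyContinuousOnInterval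
  exact (B1.mul A1).sub (B2.mul A2)

lemma weiss_deriv {j a : ℝ → ℝ} (hj : IntervalIntegrable j volume 0 1)
    (ha : IntervalIntegrable a volume 0 1) :
    ∀ᵐ s : ℝ, s ∈ Ioo (0:ℝ) 1 → deriv
      (fun r => (1 / r ^ 2) * (∫ t in (0:ℝ)..r, j t) - (1 / r) * ∫ t in (0:ℝ)..r, a t) s =
      (1 / s ^ 2) * j s - 2 / s ^ 3 * (∫ t in (0:ℝ)..s, j t) - (1 / s) * a s
        + (1 / s ^ 2) * ∫ t in (0:ℝ)..s, a t := by
  filter_upwards [hj.ae_hasDerivAt_integral, ha.ae_hasDerivAt_integral] with s e1 e2 hs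
  have hm : s ∈ uIcc (0:ℝ) 1 := by
    rw [uIcc_of_le zero_le_one]; exact Ioo_subset_Icc_self hs
  have d1 := e1 hm 0 (by simp)
  have d2 := e2 hm 0 (by simp)
  have hs0 := hs.1.ne'
  have c1 : HasDerivAt (fun r : ℝ => 1 / r ^ 2) (- 2 / s ^ 3) s := by
    have := (hasDerivAt_const s (1:ℝ)).div (hasDerivAt_pow 2 s) (pow_ne_zero 2 hs0)
    refine this.congr_deriv ?_
    simp
    field_simp
  have c2 : HasDerivAt (fun r : ℝ => 1 / r) (- 1 / s ^ 2) s := by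
    have := (hasDerivAt_const s (1:ℝ)).div (hasDerivAt_id s) hs0
    refine this.congr_deriv ?_
    simp
  have := ((c1.mul d1).sub (c2.mul d2)).deriv
  refine Eq.trans this ?_
  ring

/-! ### slices -/

lemma PLK.val_le {l K s : ℝ} {u : ℝ → ℝ → ℝ} (hu : PLK l K u) (hu0 : u 0 0 = 0)
    (hs : s ∈ Ioo (0:ℝ) 1) (θ : ℝ) : |u s θ / s| ≤ K := by
  have h1 := hu.rad s (Ioo_subset_Icc_self hs) 0 (by simp) θ
  rw [hu.vertex θ 0, hu0, sub_zero, sub_zero, abs_of_pos hs.1] at h1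
  rw [abs_div, abs_of_pos hs.1, div_le_iff₀ hs.1]
  exact h1

lemma PLK.slice_cont {l K s : ℝ} {u : ℝ → ℝ → ℝ} (hu : PLK l K u)
    (hs : s ∈ Icc (0:ℝ) 1) : Continuous (u s) := by
  have := (hu.lip_ang s).continuous
  rwa [clamp_of_mem hs] at this

lemma Ioo_fin (l : ℝ) : volume (Ioo (0:ℝ) l) < ⊤ := by simp

lemma sq_le_of_abs {x K : ℝ} (h : |x| ≤ K) : ‖x ^ 2‖ ≤ K ^ 2 := by
  rw [Real.norm_eq_abs, abs_pow]
  exact pow_le_pow_left₀ (abs_nonneg x) h 2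

lemma PLK.int_val {l K s : ℝ} {u : ℝ → ℝ → ℝ} (hu : PLK l K u) (hu0 : u 0 0 = 0)
    (hs : s ∈ Ioo (0:ℝ) 1) : IntegrableOn (fun θ => (u s θ / s) ^ 2) (Ioo 0 l) := by
  refine IntegrableOn.of_bound (Ioo_fin l) ?_ (K ^ 2) ?_
  · exact (((hu.slice_cont (Ioo_subset_Icc_self hs)).div_const s).pow 2).aestronglyMeasurable
  · exact Filter.Eventually.of_forall fun θ => sq_le_of_abs (hu.val_le hu0 hs θ)

lemma PLK.int_dr_slice {l K s : ℝ} {u : ℝ → ℝ → ℝ} (hu : PLK l K u)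
    (hs : s ∈ Ioo (0:ℝ) 1) : IntegrableOn (fun θ => (dr u (s, θ)) ^ 2) (Ioo 0 l) := by
  refine IntegrableOn.of_bound (Ioo_fin l) ?_ (K ^ 2) ?_
  · have h1 : Measurable fun p : ℝ × ℝ => deriv (fun s => u (clamp s) p.2) p.1 :=
      (measurable_deriv_with_param hu.cont').comp measurable_swap
    have h2 : (fun θ => (dr u (s, θ)) ^ 2) =
        fun θ => (deriv (fun s => u (clamp s) θ) s) ^ 2 := by
      funext θ
      rw [dr_clamp (p := (s, θ)) hs]
    rw [h2]
    exact ((h1.comp (measurable_prodMk_left (x := s))).pow_const 2).aestronglyMeasurable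
  · exact Filter.Eventually.of_forall fun θ => sq_le_of_abs (hu.dr_le (p := (s, θ)) hs)

lemma PLK.int_eden {l K s : ℝ} {u : ℝ → ℝ → ℝ} (lp lm : ℝ) (hu : PLK l K u) (hu0 : u 0 0 = 0)
    (hs : s ∈ Ioo (0:ℝ) 1) : IntegrableOn (eden lp lm u s) (Ioo 0 l) := by
  have hc := hu.slice_cont (Ioo_subset_Icc_self hs)
  refine ((hu.int_val hu0 hs).add (IntegrableOn.of_bound (Ioo_fin l)
    ?_ (K ^ 2) ?_ : IntegrableOn (fun θ => (deriv (u s) θ / s) ^ 2) (Ioo 0 l))).add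
    (IntegrableOn.of_bound (Ioo_fin l) ?_ (|lp| + |lm|) ?_)
  · exact (((measurable_deriv (u s)).div_const s).pow_const 2).aestronglyMeasurable
  · refine Filter.Eventually.of_forall fun θ => sq_le_of_abs ?_
    have := hu.da_le (p := (s, θ)) hs
    rw [abs_div, abs_of_pos hs.1, div_le_iff₀ hs.1]
    exact this
  · exact ((lam_meas lp lm).comp hc.measurable).aestronglyMeasurable
  · exact Filter.Eventually.of_forall fun θ => lam_le lp lm _

lemma PLK.slice_eq {l K s : ℝ} {u : ℝ → ℝ → ℝ} (lp lm : ℝ) (hu : PLK l K u) (hu0 : u 0 0 = 0)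
    (hs : s ∈ Ioo (0:ℝ) 1) : ∫ θ in Ioo 0 l, dens lp lm u (s, θ) =
      s * ((∫ θ in Ioo 0 l, (dr u (s, θ)) ^ 2) + (∫ θ in Ioo 0 l, eden lp lm u s θ)
        - ∫ θ in Ioo 0 l, (u s θ / s) ^ 2) := by
  have hA : IntegrableOn (fun a => dr u (s, a) ^ 2 + eden lp lm u s a) (Ioo 0 l) :=
    (hu.int_dr_slice hs).add (hu.int_eden lp lm hu0 hs)
  rw [← integral_add (hu.int_dr_slice hs) (hu.int_eden lp lm hu0 hs),
    ← integral_sub hA (hu.int_val hu0 hs),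
    ← integral_const_mul]
  congr 1
  funext θ
  have := hs.1.ne'
  unfold dens bil eden
  change (dr u (s, θ) * dr u (s, θ) + deriv (u s) θ * deriv (u s) θ / s ^ 2) * s
    + lam lp lm (u s θ) * s = _
  field_simp
  ring

lemma PLK.ftc {l K s : ℝ} {u : ℝ → ℝ → ℝ} (hu : PLK l K u) (hu0 : u 0 0 = 0)
    (hs : s ∈ Ioo (0:ℝ) 1) (θ : ℝ) : ∫ t in Ioo 0 s, dr u (t, θ) = u s θ := by
  have h1 := ((hu.lip_rad θ).lipschitzOnWith (s := uIcc 0 s)).absolutelyContinuousOnInterval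
  have h2 := h1.integral_deriv_eq_sub
  rw [clamp_of_mem (Ioo_subset_Icc_self hs), clamp_of_mem (by simp), hu.vertex θ 0, hu0, sub_zero,
    intervalIntegral.integral_of_le hs.1.le, integral_Ioc_eq_integral_Ioo] at h2
  rw [← h2]
  exact setIntegral_congr_fun measurableSet_Ioo fun t ht =>
    dr_clamp (p := (t, θ)) ⟨ht.1, ht.2.trans hs.2⟩ u

lemma PLK.int_drsq {l K : ℝ} {u : ℝ → ℝ → ℝ} (hu : PLK l K u) :
    IntegrableOn (fun p => (dr u p) ^ 2) (Sec l 0 1) := by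
  refine IntegrableOn.of_bound (Sec_vol l 0 1) (hu.dr_meas.pow 2) (K ^ 2) ?_
  filter_upwards [ae_restrict_mem (Sec_meas l 0 1)] with p hp
  exact sq_le_of_abs (hu.dr_le hp.1)

lemma PLK.int_cross {l K s : ℝ} {u : ℝ → ℝ → ℝ} (hu : PLK l K u) (hu0 : u 0 0 = 0)
    (hs : s ∈ Ioo (0:ℝ) 1) :
    IntegrableOn (fun p => dr u p * (u s p.2 / s)) (Sec l 0 1) := by
  have hc := hu.slice_cont (Ioo_subset_Icc_self hs)
  refine IntegrableOn.of_bound (Sec_vol l 0 1) (hu.dr_meas.mul ?_) (K * K) ?_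
  · exact ((hc.comp continuous_snd).div_const s).aestronglyMeasurable
  filter_upwards [ae_restrict_mem (Sec_meas l 0 1)] with p hp
  rw [norm_mul]
  exact mul_le_mul (hu.dr_le hp.1) (hu.val_le hu0 hs _) (norm_nonneg _) hu.nonneg

lemma PLK.int_valsq {l K s : ℝ} {u : ℝ → ℝ → ℝ} (hu : PLK l K u) (hu0 : u 0 0 = 0)
    (hs : s ∈ Ioo (0:ℝ) 1) :
    IntegrableOn (fun p : ℝ × ℝ => (u s p.2 / s) ^ 2) (Sec l 0 1) := by
  have hc := hu.slice_cont (Ioo_subset_Icc_self hs)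
  refine IntegrableOn.of_bound (Sec_vol l 0 1) ?_ (K ^ 2) ?_
  · exact (((hc.comp continuous_snd).div_const s).pow 2).aestronglyMeasurable
  exact Filter.Eventually.of_forall fun p => sq_le_of_abs (hu.val_le hu0 hs _)

/-- The defect from homogeneity. -/
def defect (l : ℝ) (u : ℝ → ℝ → ℝ) (s : ℝ) : ℝ :=
  ∫ p in Sec l 0 s, (dr u p - u s p.2 / s) ^ 2

lemma PLK.defect_eq {l K s : ℝ} {u : ℝ → ℝ → ℝ} (hu : PLK l K u) (hu0 : u 0 0 = 0)
    (hs : s ∈ Ioo (0:ℝ) 1) : defect l u s =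
      (∫ p in Sec l 0 s, (dr u p) ^ 2) - s * ∫ θ in Ioo 0 l, (u s θ / s) ^ 2 := by
  have hsub := Sec_mono (l := l) le_rfl hs.2.le (a := 0)
  have i1 := hu.int_drsq.mono_set hsub
  have i2 := (hu.int_cross hu0 hs).mono_set hsub
  have i3 := (hu.int_valsq hu0 hs).mono_set hsub
  have e1 : defect l u s = (∫ p in Sec l 0 s, (dr u p) ^ 2)
      - 2 * (∫ p in Sec l 0 s, dr u p * (u s p.2 / s)) + ∫ p in Sec l 0 s, (u s p.2 / s) ^ 2 := by
    have hB : IntegrableOn (fun a => dr u a ^ 2 - 2 * (dr u a * (u s a.2 / s))) (Sec l 0 s) :=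
      i1.sub (i2.const_mul 2)
    rw [← integral_const_mul, ← integral_sub i1 (i2.const_mul 2),
      ← integral_add hB i3]
    unfold defect
    congr 1
    funext p
    ring
  have e2 : ∫ p in Sec l 0 s, (u s p.2 / s) ^ 2 = s * ∫ θ in Ioo 0 l, (u s θ / s) ^ 2 := by
    rw [Sec_fubini i3]
    simp [hs.1.le]
  have e3 : ∫ p in Sec l 0 s, dr u p * (u s p.2 / s) = s * ∫ θ in Ioo 0 l, (u s θ / s) ^ 2 := by
    unfold IntegrableOn at i2
    rw [vol_Sec] at i2 ⊢
    rw [integral_prod_symm _ i2, ← integral_const_mul]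
    congr 1
    funext θ
    simp only
    rw [integral_mul_const, hu.ftc hu0 hs]
    have := hs.1.ne'
    field_simp
  rw [e1, e2, e3]
  ring

lemma defect_nonneg (l : ℝ) (u : ℝ → ℝ → ℝ) (s : ℝ) : 0 ≤ defect l u s :=
  integral_nonneg fun _ => sq_nonneg _

lemma PLK.homo_of_defect {l K s : ℝ} {u : ℝ → ℝ → ℝ} (hl : 0 < l) (hu : PLK l K u)
    (hu0 : u 0 0 = 0) (hs : s ∈ Ioo (0:ℝ) 1) (hd : defect l u s = 0) :
    ∀ t ∈ Icc 0 s, ∀ θ, u t θ = homo u s t θ := by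
  have hsub := Sec_mono (l := l) le_rfl hs.2.le (a := 0)
  have hh : PL l (homo u s) := hu.homo_PL hu0 hs
  have i1 := hu.int_drsq.mono_set hsub
  have i2 := (hu.int_cross hu0 hs).mono_set hsub
  have i3 := (hu.int_valsq hu0 hs).mono_set hsub
  have hi : Integrable (fun p => (dr u p - u s p.2 / s) ^ 2) (volume.restrict (Sec l 0 s)) := by
    refine ((i1.sub (i2.const_mul 2)).add i3).congr (Filter.Eventually.of_forall fun p => ?_)
    simp only [Pi.sub_apply, Pi.add_apply]
    ring
  have h0 := (integral_eq_zero_iff_of_nonneg (fun p => sq_nonneg (dr u p - u s p.2 / s)) hi).1 hd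
  have hdiff := ae_restrict_of_ae_restrict_of_subset hsub hu.ae_diff
  have hv : PL l (fun t θ => u t θ - homo u s t θ) := PL.sub ⟨K, hu⟩ hh
  have key := PL.const_of_dr hl hv hs.2.le (by
    filter_upwards [h0, hdiff] with p hp hd
    have h1 : dr u p - u s p.2 / s = 0 := by simpa using hp
    have h2 : dr (fun t θ => u t θ - homo u s t θ) p = dr u p - dr (homo u s) p := by
      unfold dr
      refine deriv_fun_sub hd.1 ?_
      unfold homo
      fun_prop
    rw [h2, dr_homo, h1])
  intro t ht θ
  have := key t ht θ
  simp only [hu0, homo, zero_mul, sub_zero] at this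
  unfold homo
  linarith

/-! ### conclusion -/

lemma slice_integrable {l : ℝ} {f : ℝ × ℝ → ℝ} (hf : IntegrableOn f (Sec l 0 1)) :
    IntervalIntegrable (fun t => ∫ θ in Ioo 0 l, f (t, θ)) volume 0 1 := by
  rw [intervalIntegrable_iff_integrableOn_Ioo_of_le zero_le_one]
  unfold IntegrableOn at hf
  rw [vol_Sec] at hf
  exact hf.integral_prod_left

lemma slice_integral {l r : ℝ} {f : ℝ × ℝ → ℝ} (hf : IntegrableOn f (Sec l 0 1)) (h0 : 0 ≤ r)
    (h1 : r ≤ 1) : ∫ p in Sec l 0 r, f p = ∫ t in (0:ℝ)..r, ∫ θ in Ioo 0 l, f (t, θ) := by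
  rw [Sec_fubini (hf.mono_set (Sec_mono le_rfl h1)), intervalIntegral.integral_of_le h0,
    integral_Ioc_eq_integral_Ioo]

lemma IsMinP.weiss_diff {l lp lm : ℝ} {u : ℝ → ℝ → ℝ} (hu : IsMinP l lp lm u)
    (hu0 : u 0 0 = 0) {r₁ r₂ : ℝ} (h1 : 0 < r₁) (h12 : r₁ ≤ r₂) (h2 : r₂ < 1) :
    ∃ g : ℝ → ℝ, IntervalIntegrable g volume r₁ r₂ ∧
      ∫ s in r₁..r₂, g s = Weiss l lp lm u r₂ - Weiss l lp lm u r₁ ∧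
      ∀ᵐ s : ℝ, s ∈ Ioo (0:ℝ) 1 → defect l u s / s ^ 2 ≤ g s := by
  obtain ⟨K, hK⟩ := hu.1
  have ij := hu.1.dens_int lp lm
  have ia := hK.int_drsq
  have hac := weiss_ac (slice_integrable ij) (slice_integrable ia) h1 h12 h2
  have hW : ∀ r ∈ Ioo (0:ℝ) 1, Weiss l lp lm u r =
      (1 / r ^ 2) * (∫ t in (0:ℝ)..r, ∫ θ in Ioo 0 l, dens lp lm u (t, θ))
      - (1 / r) * ∫ t in (0:ℝ)..r, ∫ θ in Ioo 0 l, (dr u (t, θ)) ^ 2 := by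
    intro r hr
    rw [Weiss_eq, slice_integral ij hr.1.le hr.2.le, slice_integral ia hr.1.le hr.2.le]
  refine ⟨_, hac.intervalIntegrable_deriv, ?_, ?_⟩
  · rw [hac.integral_deriv_eq_sub, hW r₁ ⟨h1, h12.trans_lt h2⟩, hW r₂ ⟨h1.trans_le h12, h2⟩]
  · filter_upwards [weiss_deriv (slice_integrable ij) (slice_integrable ia)] with s hs hs1
    rw [hs hs1, ← slice_integral ij hs1.1.le hs1.2.le, ← slice_integral ia hs1.1.le hs1.2.le,
      hK.defect_eq hu0 hs1, hK.slice_eq lp lm hu0 hs1]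
    have hle := hu.le_homo hu0 hs1
    set J := ∫ p in Sec l 0 s, dens lp lm u p
    set A := ∫ p in Sec l 0 s, (dr u p) ^ 2
    set a := ∫ θ in Ioo 0 l, (dr u (s, θ)) ^ 2
    set E := ∫ θ in Ioo 0 l, eden lp lm u s θ
    set U := ∫ θ in Ioo 0 l, (u s θ / s) ^ 2
    have hs0 := hs1.1
    have e : 1 / s ^ 2 * (s * (a + E - U)) - 2 / s ^ 3 * J - 1 / s * a + 1 / s ^ 2 * A
        - (A - s * U) / s ^ 2 = 2 / s ^ 3 * (s ^ 2 / 2 * E - J) := by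
      field_simp
      ring
    have : 0 ≤ 2 / s ^ 3 * (s ^ 2 / 2 * E - J) := mul_nonneg (by positivity) (by linarith)
    linarith

lemma ae_Ioc_of {r₁ r₂ : ℝ} {P : ℝ → Prop} (h1 : 0 < r₁) (h2 : r₂ < 1)
    (h : ∀ᵐ s : ℝ, s ∈ Ioo (0:ℝ) 1 → P s) : ∀ᵐ s ∂(volume.restrict (Ioc r₁ r₂)), P s := by
  rw [ae_restrict_iff' measurableSet_Ioc]
  filter_upwards [h] with s hs hm
  exact hs ⟨h1.trans hm.1, hm.2.trans_lt h2⟩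

lemma IsMinP.weiss_mono {l lp lm : ℝ} {u : ℝ → ℝ → ℝ} (hu : IsMinP l lp lm u)
    (hu0 : u 0 0 = 0) {r₁ r₂ : ℝ} (h1 : 0 < r₁) (h12 : r₁ ≤ r₂) (h2 : r₂ < 1) :
    Weiss l lp lm u r₁ ≤ Weiss l lp lm u r₂ := by
  obtain ⟨g, _, hg, hle⟩ := hu.weiss_diff hu0 h1 h12 h2
  have : 0 ≤ ∫ s in r₁..r₂, g s := by
    rw [intervalIntegral.integral_of_le h12]
    apply integral_nonneg_of_ae
    filter_upwards [ae_Ioc_of h1 h2 hle] with s hs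
    exact le_trans (div_nonneg (defect_nonneg l u s) (sq_nonneg s)) hs
  linarith

lemma IsMinP.homo_of_eq {l lp lm : ℝ} {u : ℝ → ℝ → ℝ} (hl : 0 < l) (hu : IsMinP l lp lm u)
    (hu0 : u 0 0 = 0) {r₁ r₂ : ℝ} (h1 : 0 < r₁) (h12 : r₁ < r₂) (h2 : r₂ < 1)
    (heq : Weiss l lp lm u r₁ = Weiss l lp lm u r₂) :
    ∀ t ∈ Icc r₁ r₂, ∀ θ, u t θ = homo u r₂ t θ := by
  obtain ⟨K, hK⟩ := hu.1
  obtain ⟨g, hgi, hg, hle⟩ := hu.weiss_diff hu0 h1 h12.le h2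
  have hr2 : r₂ ∈ Ioo (0:ℝ) 1 := ⟨h1.trans h12, h2⟩
  rw [heq, sub_self, intervalIntegral.integral_of_le h12.le] at hg
  have hle' := ae_Ioc_of h1 h2 hle
  have hz := (integral_eq_zero_iff_of_nonneg_ae (by
    filter_upwards [hle'] with s hs
    exact le_trans (div_nonneg (defect_nonneg l u s) (sq_nonneg s)) hs)
    ((intervalIntegrable_iff_integrableOn_Ioc_of_le h12.le).1 hgi)).1 hg
  have hgood : ∀ᵐ s ∂(volume.restrict (Ioc r₁ r₂)),
      ∀ t ∈ Icc 0 s, ∀ θ, u t θ = homo u s t θ := by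
    filter_upwards [hz, hle', ae_restrict_mem measurableSet_Ioc] with s e1 e2 hs
    have hs1 : s ∈ Ioo (0:ℝ) 1 := ⟨h1.trans hs.1, hs.2.trans_lt h2⟩
    apply hK.homo_of_defect hl hu0 hs1
    rw [e1] at e2
    have hp : 0 < s ^ 2 := pow_pos hs1.1 2
    have e3 : defect l u s ≤ 0 := by
      have := (div_le_iff₀ hp).1 e2
      simpa using this
    exact le_antisymm e3 (defect_nonneg l u s)
  intro t ht θ
  rcases eq_or_lt_of_le ht.2 with rfl | hlt
  · exact (homo_self u hr2 θ).symm
  have ht0 : 0 < t := h1.trans_le ht.1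
  -- continuity of the radial slice on the interval
  have hc : Continuous fun s => u (clamp s) θ := (hK.lip_rad θ).continuous
  by_contra hne
  have hcont : ContinuousAt (fun s => u t θ - t * (u (clamp s) θ / s)) r₂ :=
    continuousAt_const.sub (continuousAt_const.mul (hc.continuousAt.div continuousAt_id hr2.1.ne'))
  have hne' : u t θ - t * (u (clamp r₂) θ / r₂) ≠ 0 := by
    rw [clamp_of_mem (Ioo_subset_Icc_self hr2)]
    exact sub_ne_zero.2 hne
  obtain ⟨ε, hε, hball⟩ := Metric.eventually_nhds_iff.1 (hcont.eventually_ne hne')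
  set b := max t (r₂ - ε) with hb
  have hbr : b < r₂ := max_lt hlt (by linarith)
  have hbad : ∀ᵐ s ∂(volume.restrict (Ioo b r₂)), False := by
    have hsub : Ioo b r₂ ⊆ Ioc r₁ r₂ := fun s hs =>
      ⟨(ht.1.trans (le_max_left _ _)).trans_lt hs.1, hs.2.le⟩
    filter_upwards [ae_restrict_of_ae_restrict_of_subset hsub hgood,
      ae_restrict_mem measurableSet_Ioo] with s hs hm
    have hts : t < s := (le_max_left _ _).trans_lt hm.1
    have hes : r₂ - ε < s := (le_max_right _ _).trans_lt hm.1
    refine hball (y := s) ?_ ?_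
    · rw [Real.dist_eq, abs_lt]; constructor <;> linarith [hm.2]
    · rw [clamp_of_mem ⟨(ht0.trans hts).le, (hm.2.trans h2).le⟩, hs t ⟨ht0.le, hts.le⟩ θ]
      simp [homo]
  rw [Filter.eventually_false_iff_eq_bot, ae_eq_bot, Measure.restrict_eq_zero, Real.volume_Ioo,
    ENNReal.ofReal_eq_zero] at hbad
  linarith

/-- Weiss monotonicity formula on the cone of length `l`: for a minimizer `u` of
`J(C_1, λ₊, λ₋)` vanishing at the vertex, the Weiss energy is nondecreasing on `(0,1)`,
and it is constant on `[r₁, r₂]` exactly when `u` is `1`-homogeneous on the annulus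
`{r₁ ≤ r ≤ r₂}`. -/
theorem weiss_monotonicity (l lp lm : ℝ) (hl : 0 < l) (hlp : 0 ≤ lp) (hlm : 0 ≤ lm)
    (u : ℝ → ℝ → ℝ) (hu : IsMinimizerJ l lp lm 1 u) (hvertex : u 0 0 = 0) :
    (∀ r₁ ∈ Set.Ioo (0:ℝ) 1, ∀ r₂ ∈ Set.Ioo (0:ℝ) 1, r₁ ≤ r₂ →
      Weiss l lp lm u r₁ ≤ Weiss l lp lm u r₂) ∧
    (∀ r₁ ∈ Set.Ioo (0:ℝ) 1, ∀ r₂ ∈ Set.Ioo (0:ℝ) 1, r₁ < r₂ →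
      (Weiss l lp lm u r₁ = Weiss l lp lm u r₂ ↔
        ∀ s ∈ Set.Icc r₁ r₂, ∀ θ : ℝ, u s θ = s * u r₂ θ / r₂)) := by
  have hP := hu.isMin
  refine ⟨fun r₁ h1 r₂ h2 h12 => hP.weiss_mono hvertex h1.1 h12 h2.2, ?_⟩
  intro r₁ h1 r₂ h2 h12
  constructor
  · intro heq s hs θ
    rw [hP.homo_of_eq hl hvertex h1.1 h12 h2.2 heq s hs θ, homo, mul_div_assoc]
  · intro h
    have hom := hP.homo_inside hl hvertex h1 h2 h12 (fun s hs θ => by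
      rw [h s hs θ, homo, mul_div_assoc])
    rw [Weiss_homo h1.1 h12.le hom, Weiss_homo h2.1 le_rfl hom]
end
end
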